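/- arXiv:1909.04774 — 3 statements merged into one kernel-verified Lean document; each statement's English description precedes it below -/
import Mathlib

section
/- There is a universal constant α > 1 such that for all positive integers p and k with pk ≥ 2, every family of more than (α · p · log₂(pk))^k finite sets, each of size exactly k, contains a p-sunflower. -/
section Spread

open Finset

/-- The set of points whose colour lies in `A`. -/
def colorClass {V κ : Type*} [Fintype V] [DecidableEq κ] (c : V → κ) (A : Finset κ) : Finset V := {v | c v ∈ A}

lemma mem_colorClass {V κ : Type*} [Fintype V] [DecidableEq κ] {c : V → κ} {A : Finset κ}
    {v : V} : v ∈ colorClass c A ↔ c v ∈ A := by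
  simp [colorClass]

lemma card_colorings_eqOn_compl {V κ : Type*} [Fintype V] [DecidableEq V] [Fintype κ]
    (c' : V → κ) (T : Finset V) :
    (Fintype.piFinset fun v => if v ∈ T then (univ : Finset κ) else {c' v}).card =
      Fintype.card κ ^ T.card := by
  rw [Fintype.card_piFinset]
  simp only [apply_ite Finset.card, card_univ, card_singleton]
  simp

/-- `S` is captured if, using the points coloured by `A` for free, it covers a member of `F`
with at most `a` points outside `colorClass c A`. -/
def Captured {V κ : Type*} [Fintype V] [DecidableEq V] [DecidableEq κ] (F : Finset (Finset V)) (A : Finset κ)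
    (a : ℕ) (c : V → κ) (S : Finset V) : Prop :=
  ∃ S' ∈ F, (S' \ colorClass c A).card ≤ a ∧ S' ⊆ S ∪ colorClass c A

lemma exists_fragment_map {V κ : Type*} [Fintype V] [DecidableEq V] [DecidableEq κ]
    (F : Finset (Finset V)) {A : Finset κ} {x : κ} (hx : x ∉ A) (a b : ℕ) :
    ∃ H : (V → κ) → Finset V, (∀ c, (H c).card ≤ a) ∧
      ∀ c S, Captured F A a c S → ¬ Captured F (insert x A) b c S →
        ∃ c' T, T ⊆ H c' ∧ b < T.card ∧ (∀ v ∉ T, c v = c' v) ∧ T ⊆ S := by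
  classical
  have key : ∀ c' : V → κ, ∃ H : Finset V, H.card ≤ a ∧
      ((∃ S' ∈ F, (S' \ colorClass c' A).card ≤ a ∧ S' ⊆ colorClass c' (insert x A)) →
        ∃ S' ∈ F, (S' \ colorClass c' A).card ≤ a ∧ S' ⊆ colorClass c' (insert x A) ∧
          H = S' \ colorClass c' A) := by
    intro c'
    by_cases h : ∃ S' ∈ F, (S' \ colorClass c' A).card ≤ a ∧ S' ⊆ colorClass c' (insert x A)
    · obtain ⟨S', h1, h2, h3⟩ := h
      exact ⟨S' \ colorClass c' A, h2, fun _ => ⟨S', h1, h2, h3, rfl⟩⟩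
    · exact ⟨∅, by simp, fun h' => absurd h' h⟩
  choose H hcard hH using key
  refine ⟨H, hcard, ?_⟩
  rintro c S ⟨S₀, hS₀, hS₀a, hS₀S⟩ hnot
  have hmono : colorClass c A ⊆ colorClass c (insert x A) := fun v hv => by
    rw [mem_colorClass] at *; exact mem_insert_of_mem hv
  obtain ⟨S', hS', hmin⟩ := exists_min_image
    (F.filter fun S' => (S' \ colorClass c A).card ≤ a ∧ S' ⊆ S ∪ colorClass c (insert x A))
    (fun S' => (S' \ colorClass c (insert x A)).card)
    ⟨S₀, mem_filter.2 ⟨hS₀, hS₀a, hS₀S.trans (union_subset_union_right hmono)⟩⟩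
  obtain ⟨hS'F, hS'a, hS'S⟩ := mem_filter.1 hS'
  set T := S' \ colorClass c (insert x A) with hT
  have hTS : T ⊆ S := fun v hv => by
    obtain ⟨h1, h2⟩ := mem_sdiff.1 hv
    exact (mem_union.1 (hS'S h1)).resolve_right h2
  have hTc : ∀ v ∈ T, c v ≠ x ∧ c v ∉ A := fun v hv => by
    have := (mem_sdiff.1 hv).2
    rw [mem_colorClass, mem_insert] at this
    tauto
  set c' : V → κ := fun v => if v ∈ T then x else c v with hc'
  have hU : colorClass c' A = colorClass c A := by
    ext v
    simp only [mem_colorClass, hc']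
    split_ifs with hv
    · simp [hx, (hTc v hv).2]
    · rfl
  have hU' : colorClass c' (insert x A) = colorClass c (insert x A) ∪ T := by
    ext v
    simp only [mem_colorClass, hc', mem_union]
    split_ifs with hv <;> simp [hv]
  obtain ⟨Ŝ, hŜ, hŜa, hŜU, hHŜ⟩ := hH c' ⟨S', hS'F, by rwa [hU], fun v hv => by
    rw [hU', mem_union, hT, mem_sdiff]; tauto⟩
  rw [hU] at hŜa
  rw [hU'] at hŜU
  have hsub : Ŝ \ colorClass c (insert x A) ⊆ T := fun v hv => by
    obtain ⟨h1, h2⟩ := mem_sdiff.1 hv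
    exact (mem_union.1 (hŜU h1)).resolve_left h2
  have hle := hmin Ŝ (mem_filter.2 ⟨hŜ, hŜa, fun v hv => by
    rcases mem_union.1 (hŜU hv) with h | h
    · exact mem_union_right _ h
    · exact mem_union_left _ (hTS h)⟩)
  have heq := eq_of_subset_of_card_le hsub hle
  refine ⟨c', T, ?_, ?_, fun v hv => by simp [hc', hv], hTS⟩
  · rw [hHŜ, hU]
    exact heq ▸ sdiff_subset_sdiff subset_rfl hmono
  · by_contra! hb
    exact hnot ⟨S', hS'F, hb, hS'S⟩

variable {V κ : Type*} [Fintype V] [DecidableEq V] [Fintype κ] [DecidableEq κ]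

open Classical in
lemma card_captured_not_captured_insert (F : Finset (Finset V))
    (hF : ∀ T : Finset V, (8 * Fintype.card κ) ^ T.card * (F.filter (T ⊆ ·)).card ≤ F.card)
    {A : Finset κ} {x : κ} (hx : x ∉ A) (a b : ℕ) :
    8 ^ (b + 1) * (((univ : Finset (V → κ)) ×ˢ F).filter fun q =>
        Captured F A a q.1 q.2 ∧ ¬ Captured F (insert x A) b q.1 q.2).card ≤
      2 ^ a * (Fintype.card (V → κ) * F.card) := by
  obtain ⟨H, hH, hcov⟩ := exists_fragment_map F hx a b
  set E : (V → κ) → Finset V → Finset ((V → κ) × Finset V) := fun c' T =>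
    (Fintype.piFinset fun v => if v ∈ T then (univ : Finset κ) else {c' v}) ×ˢ
      F.filter (T ⊆ ·) with hE
  have hsub : (((univ : Finset (V → κ)) ×ˢ F).filter fun q =>
      Captured F A a q.1 q.2 ∧ ¬ Captured F (insert x A) b q.1 q.2) ⊆
      univ.biUnion fun c' => ((H c').powerset.filter (b < ·.card)).biUnion (E c') := by
    rintro ⟨c, S⟩ hq
    simp only [mem_filter, mem_product, mem_univ, true_and] at hq
    obtain ⟨c', T, h1, h2, h3, h4⟩ := hcov c S hq.2.1 hq.2.2
    simp only [mem_biUnion, mem_univ, true_and, mem_filter, mem_powerset]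
    refine ⟨c', T, ⟨h1, h2⟩, ?_⟩
    simp only [hE, mem_product, Fintype.mem_piFinset, mem_filter]
    refine ⟨fun v => ?_, hq.1, h4⟩
    by_cases hv : v ∈ T
    · simp [hv]
    · simp [hv, h3 v hv]
  have hEcard : ∀ c' T, b < T.card → 8 ^ (b + 1) * (E c' T).card ≤ F.card := by
    intro c' T hT
    rw [hE, card_product, card_colorings_eqOn_compl]
    calc _ ≤ 8 ^ T.card * (Fintype.card κ ^ T.card * (F.filter (T ⊆ ·)).card) :=
          Nat.mul_le_mul_right _ (Nat.pow_le_pow_right (by norm_num) hT)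
      _ = (8 * Fintype.card κ) ^ T.card * (F.filter (T ⊆ ·)).card := by rw [mul_pow, mul_assoc]
      _ ≤ F.card := hF T
  calc _ ≤ 8 ^ (b + 1) * ∑ c', ∑ T ∈ (H c').powerset.filter (b < ·.card), (E c' T).card := by
        refine Nat.mul_le_mul_left _ ((card_le_card hsub).trans (card_biUnion_le.trans ?_))
        exact sum_le_sum fun c' _ => card_biUnion_le
    _ = ∑ c', ∑ T ∈ (H c').powerset.filter (b < ·.card), 8 ^ (b + 1) * (E c' T).card := by
        simp only [mul_sum]
    _ ≤ ∑ _c' : V → κ, 2 ^ a * F.card := by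
        refine sum_le_sum fun c' _ => ?_
        refine (sum_le_card_nsmul _ _ F.card fun T hT => hEcard c' T (mem_filter.1 hT).2).trans ?_
        rw [smul_eq_mul]
        refine Nat.mul_le_mul_right _ ((card_filter_le _ _).trans ?_)
        rw [card_powerset]
        exact Nat.pow_le_pow_right (by norm_num) (hH c')
    _ = _ := by rw [sum_const, card_univ, smul_eq_mul]; ring

open Classical in
lemma card_not_captured_le (F : Finset (Finset V)) {k : ℕ} (hk : ∀ S ∈ F, S.card = k)
    (hF : ∀ T : Finset V, (8 * Fintype.card κ) ^ T.card * (F.filter (T ⊆ ·)).card ≤ F.card)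
    (A : Finset κ) (i : ℕ) (hi : k < 2 ^ (i + A.card)) :
    2 ^ (i + 1) * (((univ : Finset (V → κ)) ×ˢ F).filter fun q =>
        ¬ Captured F A (2 ^ i - 1) q.1 q.2).card ≤ Fintype.card (V → κ) * F.card := by
  induction A using Finset.induction_on generalizing i with
  | empty =>
    rw [filter_eq_empty_iff.2]
    · simp
    · rintro ⟨c, S⟩ hq
      have hS := (mem_product.1 hq).2
      refine not_not.2 ⟨S, hS, (card_le_card sdiff_subset).trans ?_, subset_union_left⟩
      rw [hk S hS]
      simp only [card_empty, add_zero] at hi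
      omega
  | insert x A hx ih =>
    rw [card_insert_of_notMem hx] at hi
    have h1 := ih (i + 1) (by convert hi using 2; ring)
    have h2 := card_captured_not_captured_insert F hF hx (2 ^ (i + 1) - 1) (2 ^ i - 1)
    have hsub : (((univ : Finset (V → κ)) ×ˢ F).filter fun q =>
        ¬ Captured F (insert x A) (2 ^ i - 1) q.1 q.2) ⊆
        (((univ : Finset (V → κ)) ×ˢ F).filter fun q =>
          ¬ Captured F A (2 ^ (i + 1) - 1) q.1 q.2) ∪
        (((univ : Finset (V → κ)) ×ˢ F).filter fun q => Captured F A (2 ^ (i + 1) - 1) q.1 q.2 ∧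
          ¬ Captured F (insert x A) (2 ^ i - 1) q.1 q.2) := by
      intro q hq
      simp only [mem_union, mem_filter] at hq ⊢
      tauto
    have h3 := (card_le_card hsub).trans (card_union_le _ _)
    have hpow : 2 ^ (i + 2) * 2 ^ (2 ^ (i + 1) - 1) ≤ 8 ^ (2 ^ i - 1 + 1) := by
      have hlt : i < 2 ^ i := Nat.lt_two_pow_self
      rw [← pow_add, show 8 = 2 ^ 3 by norm_num, ← pow_mul]
      refine Nat.pow_le_pow_right (by norm_num) ?_
      rw [pow_succ]
      omega
    have combine : ∀ X Y Z D : ℕ, 2 ^ (i + 2) * X ≤ D →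
        8 ^ (2 ^ i - 1 + 1) * Y ≤ 2 ^ (2 ^ (i + 1) - 1) * D → Z ≤ X + Y →
        2 ^ (i + 1) * Z ≤ D := by
      intro X Y Z D hX hY hZ
      have hY' : 2 ^ (i + 2) * Y ≤ D := by
        refine Nat.le_of_mul_le_mul_left (c := 2 ^ (2 ^ (i + 1) - 1)) ?_ (by positivity)
        calc _ = 2 ^ (i + 2) * 2 ^ (2 ^ (i + 1) - 1) * Y := by ring
          _ ≤ _ := (Nat.mul_le_mul_right _ hpow).trans hY
      have hZ' : 2 ^ (i + 1) * Z ≤ 2 ^ (i + 1) * (X + Y) := Nat.mul_le_mul_left _ hZ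
      rw [show 2 ^ (i + 2) = 2 * 2 ^ (i + 1) by ring] at hX hY'
      nlinarith
    exact combine _ _ _ _ h1 h2 h3

open Classical in
lemma card_colorings_covering (F : Finset (Finset V)) (hne : F.Nonempty) {k : ℕ}
    (hk : ∀ S ∈ F, S.card = k)
    (hF : ∀ T : Finset V, (8 * Fintype.card κ) ^ T.card * (F.filter (T ⊆ ·)).card ≤ F.card)
    (A : Finset κ) (hA : k < 2 ^ A.card) :
    Fintype.card (V → κ) ≤
      2 * ((univ : Finset (V → κ)).filter fun c => ∃ S ∈ F, S ⊆ colorClass c A).card := by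
  have h := card_not_captured_le F hk hF A 0 (by simpa using hA)
  have hsub : ((univ : Finset (V → κ)).filter fun c => ¬ ∃ S ∈ F, S ⊆ colorClass c A) ×ˢ F ⊆
      ((univ : Finset (V → κ)) ×ˢ F).filter fun q => ¬ Captured F A (2 ^ 0 - 1) q.1 q.2 := by
    rintro ⟨c, S⟩ hq
    simp only [mem_product, mem_filter, mem_univ, true_and] at hq ⊢
    refine ⟨hq.2, ?_⟩
    rintro ⟨S', hS', h0, -⟩
    refine hq.1 ⟨S', hS', ?_⟩
    simpa [sdiff_eq_empty_iff_subset] using h0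
  have h1 := card_le_card hsub
  rw [card_product] at h1
  have h2 : 2 * ((univ : Finset (V → κ)).filter
      fun c => ¬ ∃ S ∈ F, S ⊆ colorClass c A).card ≤ Fintype.card (V → κ) := by
    refine Nat.le_of_mul_le_mul_right ?_ hne.card_pos
    calc _ = 2 ^ (0 + 1) * (((univ : Finset (V → κ)).filter
          fun c => ¬ ∃ S ∈ F, S ⊆ colorClass c A).card * F.card) := by ring
      _ ≤ _ := (Nat.mul_le_mul_left _ h1).trans h
  have h3 := card_filter_add_card_filter_not (s := (univ : Finset (V → κ)))
    (fun c => ∃ S ∈ F, S ⊆ colorClass c A)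
  rw [card_univ] at h3
  omega

open Classical in
lemma exists_pairwise_disjoint_of_spread {p L k : ℕ} (hL : 0 < L) (hk0 : 0 < k)
    (hkL : k < 2 ^ L) (F : Finset (Finset V)) (hne : F.Nonempty) (hk : ∀ S ∈ F, S.card = k)
    (hF : ∀ T : Finset V, (16 * p * L) ^ T.card * (F.filter (T ⊆ ·)).card ≤ F.card) :
    ∃ P ⊆ F, P.card = p ∧ ∀ S ∈ P, ∀ T ∈ P, S ≠ T → S ∩ T = ∅ := by
  rcases Nat.eq_zero_or_pos p with rfl | hp
  · exact ⟨∅, by simp, by simp, by simp⟩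
  set A : Fin (2 * p) → Finset (Fin (2 * p) × Fin L) := fun a => {a} ×ˢ univ with hA
  have hhalf : ∀ a, Fintype.card (V → Fin (2 * p) × Fin L) ≤
      2 * ((univ : Finset (V → Fin (2 * p) × Fin L)).filter
        fun c => ∃ S ∈ F, S ⊆ colorClass c (A a)).card := fun a => by
    refine card_colorings_covering F hne hk (fun T => ?_) (A a) (by simpa [hA] using hkL)
    convert hF T using 3
    simp only [Fintype.card_prod, Fintype.card_fin]
    ring
  have hcount : ∑ c : V → Fin (2 * p) × Fin L, p ≤ ∑ c : V → Fin (2 * p) × Fin L,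
      ((univ : Finset (Fin (2 * p))).filter fun a => ∃ S ∈ F, S ⊆ colorClass c (A a)).card := by
    have hswap : ∑ c : V → Fin (2 * p) × Fin L,
        ((univ : Finset (Fin (2 * p))).filter fun a => ∃ S ∈ F, S ⊆ colorClass c (A a)).card =
        ∑ a, ((univ : Finset (V → Fin (2 * p) × Fin L)).filter
          fun c => ∃ S ∈ F, S ⊆ colorClass c (A a)).card := by
      simp only [card_filter]
      exact sum_comm
    have hsum := sum_le_sum fun a (_ : a ∈ univ) => hhalf a
    rw [← mul_sum, ← hswap, sum_const, card_univ, Fintype.card_fin, smul_eq_mul] at hsum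
    rw [sum_const, card_univ, smul_eq_mul]
    linarith
  have : Nonempty (Fin (2 * p) × Fin L) := ⟨⟨0, by omega⟩, ⟨0, hL⟩⟩
  obtain ⟨c, -, hc⟩ := exists_le_of_sum_le univ_nonempty hcount
  obtain ⟨J, hJ, hJp⟩ := exists_subset_card_eq hc
  have hJ' : ∀ a ∈ J, ∃ S ∈ F, S ⊆ colorClass c (A a) := fun a ha => (mem_filter.1 (hJ ha)).2
  choose! g hgF hgc using hJ'
  have hdisj : ∀ a ∈ J, ∀ b ∈ J, a ≠ b → g a ∩ g b = ∅ := by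
    intro a ha b hb hab
    refine eq_empty_of_forall_notMem fun v hv => hab ?_
    have h1 := mem_colorClass.1 (hgc a ha (mem_inter.1 hv).1)
    have h2 := mem_colorClass.1 (hgc b hb (mem_inter.1 hv).2)
    simp only [hA, mem_product, mem_singleton] at h1 h2
    exact h1.1.symm.trans h2.1
  refine ⟨J.image g, image_subset_iff.2 hgF, ?_, ?_⟩
  · rw [card_image_of_injOn, hJp]
    intro a ha b hb hab
    by_contra hne'
    have h0 := hdisj a ha b hb hne'
    rw [← hab, inter_self] at h0
    have := hk _ (hgF a ha)
    simp [h0] at this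
    omega
  · simp only [forall_mem_image]
    exact fun a ha b hb hab => hdisj a ha b hb fun h => hab (h ▸ rfl)

/-- `F` contains a `p`-sunflower. -/
def HasSunflower {V : Type*} [DecidableEq V] (F : Finset (Finset V)) (p : ℕ) : Prop :=
  ∃ P ⊆ F, P.card = p ∧ ∃ Y : Finset V, ∀ S ∈ P, ∀ T ∈ P, S ≠ T → S ∩ T = Y

lemma HasSunflower.of_link {V : Type*} [DecidableEq V] {F : Finset (Finset V)} {p : ℕ}
    {T : Finset V} (h : HasSunflower ((F.filter (T ⊆ ·)).image (· \ T)) p) :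
    HasSunflower F p := by
  obtain ⟨P, hPG, hPp, Y, hY⟩ := h
  have hP : ∀ S ∈ P, S ∪ T ∈ F ∧ Disjoint S T := by
    intro S hS
    obtain ⟨S₀, hS₀, rfl⟩ := mem_image.1 (hPG hS)
    obtain ⟨h1, h2⟩ := mem_filter.1 hS₀
    exact ⟨by rwa [sdiff_union_of_subset h2], sdiff_disjoint⟩
  refine ⟨P.image (· ∪ T), image_subset_iff.2 fun S hS => (hP S hS).1, ?_, Y ∪ T, ?_⟩
  · rw [card_image_of_injOn, hPp]
    intro S hS S' hS' h
    have h' := congrArg (· \ T) h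
    simpa [union_sdiff_right, sdiff_eq_self_of_disjoint (hP S hS).2,
      sdiff_eq_self_of_disjoint (hP S' hS').2] using h'
  · simp only [forall_mem_image]
    intro S hS S' hS' h
    rw [← inter_union_distrib_right, hY S hS S' hS' fun h' => h (h' ▸ rfl)]

lemma hasSunflower_of_pow_lt_card {p L k : ℕ} (hkL : k < 2 ^ L)
    (F : Finset (Finset V)) (hk : ∀ S ∈ F, S.card = k) (hF : (16 * p * L) ^ k < F.card) :
    HasSunflower F p := by
  induction k using Nat.strong_induction_on generalizing F with
  | _ k ih =>
  rcases Nat.eq_zero_or_pos k with rfl | hk0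
  · have : F ⊆ {∅} := fun S hS => mem_singleton.2 (card_eq_zero.1 (hk S hS))
    have := card_le_card this
    simp at hF this
    omega
  have hL : 0 < L := by
    rcases Nat.eq_zero_or_pos L with rfl | h
    · simp at hkL; omega
    · exact h
  by_cases hspread :
      ∀ T : Finset V, (16 * p * L) ^ T.card * (F.filter (T ⊆ ·)).card ≤ F.card
  · obtain ⟨P, h1, h2, h3⟩ := exists_pairwise_disjoint_of_spread hL hk0 hkL F
      (card_pos.1 (by omega)) hk hspread
    exact ⟨P, h1, h2, ∅, h3⟩
  push Not at hspread
  obtain ⟨T, hT⟩ := hspread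
  have hT0 : 0 < T.card := by
    rw [card_pos, nonempty_iff_ne_empty]
    rintro rfl
    simp at hT
  have hFT : (F.filter (T ⊆ ·)).Nonempty := by
    rw [← card_pos]
    by_contra! h
    simp [Nat.le_zero.1 h] at hT
  obtain ⟨S₀, hS₀⟩ := hFT
  have hTk : T.card ≤ k := by
    rw [← hk S₀ (mem_filter.1 hS₀).1]
    exact card_le_card (mem_filter.1 hS₀).2
  refine HasSunflower.of_link (T := T) (ih (k - T.card) (by omega) (by omega) _ ?_ ?_)
  · simp only [forall_mem_image, mem_filter]
    rintro S ⟨hS, hTS⟩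
    rw [card_sdiff_of_subset hTS, hk S hS]
  · rw [card_image_of_injOn]
    · refine lt_of_mul_lt_mul_left (a := (16 * p * L) ^ T.card) ?_ (Nat.zero_le _)
      rw [← pow_add, Nat.add_sub_cancel' hTk]
      exact hF.trans hT
    · intro S hS S' hS' h
      simp only [coe_filter, Set.mem_ofPred_eq] at hS hS'
      rw [← sdiff_union_of_subset hS.2, ← sdiff_union_of_subset hS'.2]
      exact congrArg (· ∪ T) h

lemma HasSunflower.of_subtype {V : Type*} [DecidableEq V] {X : Finset V}
    {F : Finset (Finset V)} (hX : ∀ S ∈ F, S ⊆ X) {p : ℕ}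
    (h : HasSunflower (F.image (Finset.subtype (· ∈ X))) p) : HasSunflower F p := by
  obtain ⟨P, hPG, hPp, Y, hY⟩ := h
  refine ⟨P.map (mapEmbedding (Function.Embedding.subtype _)).toEmbedding, ?_,
    by rw [card_map, hPp], Y.map (Function.Embedding.subtype _), ?_⟩
  · intro S hS
    obtain ⟨S', hS', rfl⟩ := mem_map.1 hS
    obtain ⟨S₀, hS₀, rfl⟩ := mem_image.1 (hPG hS')
    rw [RelEmbedding.coe_toEmbedding, mapEmbedding_apply, subtype_map_of_mem (hX S₀ hS₀)]
    exact hS₀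
  · simp only [forall_mem_map]
    intro S hS S' hS' h
    simp only [RelEmbedding.coe_toEmbedding, mapEmbedding_apply] at h ⊢
    rw [← map_inter, hY S hS S' hS' fun h' => h (h' ▸ rfl)]

end Spread


/-- **Sunflower theorem** (Alweiss–Lovett–Wu–Zhang / Rao).
There is a universal constant `α > 1` such that for all positive integers `p`, `k` with
`p * k ≥ 2`, every family of more than `(α * p * log₂ (p * k)) ^ k` finite sets, each of
size exactly `k`, contains a `p`-sunflower: `p` distinct sets whose pairwise intersections
are all equal to a common set `Y`. -/
theorem sunflower_theorem :
    ∃ α : ℝ, 1 < α ∧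
      ∀ (V : Type*) [DecidableEq V] (p k : ℕ) (F : Finset (Finset V)),
        0 < p → 0 < k → 2 ≤ p * k →
        (∀ S ∈ F, S.card = k) →
        (α * p * Real.logb 2 (p * k)) ^ k < (F.card : ℝ) →
        ∃ P ⊆ F, P.card = p ∧
          ∃ Y : Finset V, ∀ S ∈ P, ∀ T ∈ P, S ≠ T → S ∩ T = Y := by
  refine ⟨32, by norm_num, ?_⟩
  intro V _ p k F hp hk hpk hcard hF
  set X : Finset V := F.sup id
  have hX : ∀ S ∈ F, S ⊆ X := fun S hS => Finset.le_sup (f := id) hS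
  refine HasSunflower.of_subtype hX
    (hasSunflower_of_pow_lt_card (L := Nat.log 2 k + 1)
      (Nat.lt_pow_succ_log_self (by norm_num) k) _ ?_ ?_)
  · simp only [Finset.forall_mem_image]
    intro S hS
    rw [← hcard S hS, ← Finset.card_map (Function.Embedding.subtype _),
      Finset.subtype_map_of_mem (hX S hS)]
  · rw [Finset.card_image_of_injOn]
    · have hp' : (1 : ℝ) ≤ p := by exact_mod_cast hp
      have hk' : (1 : ℝ) ≤ k := by exact_mod_cast hk
      have hpk' : (2 : ℝ) ≤ p * k := by exact_mod_cast hpk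
      have h1 : (1 : ℝ) ≤ Real.logb 2 (p * k) := by
        rw [Real.le_logb_iff_rpow_le (by norm_num) (by positivity)]
        simpa using hpk'
      have h2 : (Nat.log 2 k : ℝ) ≤ Real.logb 2 (p * k) :=
        (by exact_mod_cast Real.natLog_le_logb k 2 : (Nat.log 2 k : ℝ) ≤ Real.logb 2 k).trans
          (Real.logb_le_logb_of_le (by norm_num) (by positivity) (by nlinarith))
      have h3 : (16 * p * (Nat.log 2 k + 1) : ℝ) ≤ 32 * p * Real.logb 2 (p * k) := by
        nlinarith
      have h4 := (pow_le_pow_left₀ (by positivity) h3 k).trans_lt hF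
      exact_mod_cast h4
    · intro S hS S' hS' h
      rw [← Finset.subtype_map_of_mem (hX S hS), ← Finset.subtype_map_of_mem (hX S' hS')]
      exact congrArg (Finset.map _) h
end

section
/- There is a universal constant β > 1 such that the following holds. Let 0 < γ < 1/2 and 0 < ε < 1/2, let k, n be positive integers, and set r = β · (1/γ) · log₂(k/ε). Suppose S_1, …, S_ℓ ⊆ [n] is an r-spread sequence of at least r^k sets, each of size exactly k. If W ⊆ [n] is a uniformly random set of a fixed size that is at least γn, then the probability that there exists an index y ∈ [ℓ] with S_y ⊆ W is strictly greater than 1 − ε. -/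
/-- Given a family `T` and a set `U`, every member `T y` has a residue `T' y = T j \ U ⊆ T y`
that is as small as possible among the members `T j ⊆ T y ∪ U` with `#(T j) ≤ #(T y)`. -/
theorem exists_minimal_residue {α ι : Type*} [DecidableEq α] [Fintype ι]
    (T : ι → Finset α) (U : Finset α) :
    ∃ T' : ι → Finset α,
      (∀ y, T' y ⊆ T y) ∧
      (∀ y, ∃ j, (T j).card ≤ (T y).card ∧ T' y = T j \ U) ∧
      ∀ y j, (T j).card ≤ (T y).card → T j ⊆ T' y ∪ U → T' y ⊆ T j := by
  have key : ∀ y, ∃ F : Finset α, F ⊆ T y ∧ (∃ j, (T j).card ≤ (T y).card ∧ F = T j \ U) ∧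
      ∀ j, (T j).card ≤ (T y).card → T j ⊆ F ∪ U → F ⊆ T j := by
    intro y
    obtain ⟨j, hj, hmin⟩ := Finset.exists_min_image
      (Finset.univ.filter fun j => (T j).card ≤ (T y).card ∧ T j ⊆ T y ∪ U)
      (fun j => (T j \ U).card) ⟨y, by simp⟩
    simp only [Finset.mem_filter, Finset.mem_univ, true_and] at hj hmin
    have hsub : T j \ U ⊆ T y := by
      intro x hx
      have := hj.2 (Finset.mem_sdiff.1 hx).1
      simp only [Finset.mem_sdiff, Finset.mem_union] at hx this
      tauto
    refine ⟨T j \ U, hsub, ⟨j, hj.1, rfl⟩, fun i hi hiU => ?_⟩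
    have hi' : T i \ U ⊆ T j \ U := by
      intro x hx
      have := hiU (Finset.mem_sdiff.1 hx).1
      simp only [Finset.mem_sdiff, Finset.mem_union] at hx this ⊢
      tauto
    have hcard := hmin i ⟨hi, hiU.trans (Finset.union_subset_union_left hsub)⟩
    rw [← Finset.eq_of_subset_of_card_le hi' hcard]
    exact Finset.sdiff_subset
  choose F h₁ h₂ h₃ using key
  exact ⟨F, h₁, h₂, h₃⟩

/-- Codes the pairs `(U, y)` whose residue `R U y` has size `t` by the triples
`(R U y ∪ U, R U y, y)`: the second entry is contained in a set of size at most `s` that depends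
only on the first. -/
theorem card_residue_pairs_le {α ι : Type*} [DecidableEq α] [Fintype ι]
    (A : Finset α) (T : ι → Finset α) (hTA : ∀ y, T y ⊆ A) (u s t : ℕ)
    (R : Finset α → ι → Finset α) (hR : ∀ U y, R U y ⊆ T y)
    (hRj : ∀ U y, ∃ j, (T j).card ≤ (T y).card ∧ R U y = T j \ U)
    (hRmin : ∀ U y j, (T j).card ≤ (T y).card → T j ⊆ R U y ∪ U → R U y ⊆ T j)
    (d : ℝ) (hd_nonneg : 0 ≤ d) (hd : ∀ Z : Finset α, Z.card = t →
      ((Finset.univ.filter fun y => Z ⊆ T y).card : ℝ) ≤ d) :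
    ((((A.powersetCard u) ×ˢ (Finset.univ : Finset ι)).filter
        fun p => (T p.2).card = s ∧ (R p.1 p.2).card = t).card : ℝ)
      ≤ (A.card.choose (u + t) : ℝ) * (2 ^ s * d) := by
  classical
  have hG : ∀ Z : Finset α, ∃ G : Finset α, G.card ≤ s ∧
      ((∃ j, (T j).card ≤ s ∧ T j ⊆ Z) → ∃ j, (T j).card ≤ s ∧ T j ⊆ Z ∧ T j = G) := by
    intro Z
    by_cases h : ∃ j, (T j).card ≤ s ∧ T j ⊆ Z
    · obtain ⟨j, h₁, h₂⟩ := h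
      exact ⟨T j, h₁, fun _ => ⟨j, h₁, h₂, rfl⟩⟩
    · exact ⟨∅, by simp, fun h' => (h h').elim⟩
  choose G hGs hGj using hG
  have hcode : (((A.powersetCard u) ×ˢ (Finset.univ : Finset ι)).filter
        fun p => (T p.2).card = s ∧ (R p.1 p.2).card = t).card ≤
      ((A.powersetCard (u + t)).sigma fun Z => ((G Z).powersetCard t).sigma fun F =>
        Finset.univ.filter fun y => F ⊆ T y).card := by
    have hdisj : ∀ U y, Disjoint (R U y) U := by
      intro U y
      obtain ⟨j, -, hj⟩ := hRj U y
      rw [hj]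
      exact Finset.sdiff_disjoint
    refine Finset.card_le_card_of_injOn
      (fun p => ⟨R p.1 p.2 ∪ p.1, R p.1 p.2, p.2⟩) ?_ ?_
    · rintro ⟨U, y⟩ hp
      simp only [Finset.coe_filter, Finset.mem_product, Finset.mem_powersetCard,
        Finset.mem_univ, and_true, Set.mem_ofPred_eq] at hp
      obtain ⟨⟨hUA, hUu⟩, hs, ht⟩ := hp
      simp only [Finset.coe_sigma, Set.mem_sigma_iff, Finset.mem_coe, Finset.mem_powersetCard,
        Finset.mem_filter, Finset.mem_univ, true_and]
      refine ⟨⟨Finset.union_subset ((hR U y).trans (hTA y)) hUA, ?_⟩, ⟨?_, ht⟩, hR U y⟩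
      · rw [Finset.card_union_of_disjoint (hdisj U y), ht, hUu, add_comm]
      · obtain ⟨j, hjs, hj⟩ := hRj U y
        obtain ⟨i, his, hiZ, hiG⟩ := hGj (R U y ∪ U) ⟨j, hs ▸ hjs, by rw [hj]; simp⟩
        rw [← hiG]
        exact hRmin U y i (hs ▸ his) hiZ
    · rintro ⟨U, y⟩ - ⟨V, z⟩ - h
      simp only [Sigma.mk.injEq] at h
      obtain ⟨h₁, h₂⟩ := h
      have h₃ : R U y = R V z ∧ y = z := by
        simpa using h₂
      obtain ⟨h₃, rfl⟩ := h₃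
      have hU : U = (R U y ∪ U) \ R U y := by
        rw [Finset.union_sdiff_left, Finset.sdiff_eq_self_of_disjoint (hdisj U y).symm]
      have hV : V = (R V y ∪ V) \ R V y := by
        rw [Finset.union_sdiff_left, Finset.sdiff_eq_self_of_disjoint (hdisj V y).symm]
      rw [Prod.mk.injEq]
      exact ⟨by rw [hU, hV, ← h₁, ← h₃], rfl⟩
  have hd₀ : ∀ Z ∈ A.powersetCard (u + t),
      ∑ F ∈ (G Z).powersetCard t, ((Finset.univ.filter fun y => F ⊆ T y).card : ℝ)
        ≤ 2 ^ s * d := by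
    intro Z _
    calc ∑ F ∈ (G Z).powersetCard t, ((Finset.univ.filter fun y => F ⊆ T y).card : ℝ)
        ≤ ((G Z).powersetCard t).card • d :=
          Finset.sum_le_card_nsmul _ _ _ fun F hF => hd F (Finset.mem_powersetCard.1 hF).2
      _ ≤ 2 ^ s * d := by
          rw [nsmul_eq_mul, Finset.card_powersetCard]
          gcongr
          calc (((G Z).card.choose t : ℕ) : ℝ) ≤ 2 ^ (G Z).card := by
                exact_mod_cast Nat.choose_le_two_pow _ _
            _ ≤ 2 ^ s := pow_le_pow_right₀ (by norm_num) (hGs Z)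
  calc _ ≤ _ := Nat.cast_le.2 hcode
    _ = ∑ Z ∈ A.powersetCard (u + t), ∑ F ∈ (G Z).powersetCard t,
          ((Finset.univ.filter fun y => F ⊆ T y).card : ℝ) := by
        simp [Finset.card_sigma]
    _ ≤ (A.powersetCard (u + t)).card • (2 ^ s * d) := Finset.sum_le_card_nsmul _ _ _ hd₀
    _ = _ := by rw [nsmul_eq_mul, Finset.card_powersetCard]

theorem choose_add_mul_pow_le (N u t : ℕ) :
    N.choose (u + t) * u ^ t ≤ N.choose u * N ^ t := by
  induction t with
  | zero => simp
  | succ t ih =>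
    have h₁ : N.choose (u + t + 1) * u ≤ N.choose (u + t) * N := by
      calc N.choose (u + t + 1) * u ≤ N.choose (u + t + 1) * (u + t + 1) := by gcongr; omega
        _ = N.choose (u + t) * (N - (u + t)) := Nat.choose_succ_right_eq _ _
        _ ≤ N.choose (u + t) * N := by gcongr; omega
    calc N.choose (u + (t + 1)) * u ^ (t + 1)
        = N.choose (u + t + 1) * u * u ^ t := by rw [← add_assoc]; ring
      _ ≤ N.choose (u + t) * N * u ^ t := by gcongr
      _ = N.choose (u + t) * u ^ t * N := by ring
      _ ≤ N.choose u * N ^ t * N := by gcongr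
      _ = N.choose u * N ^ (t + 1) := by ring

/-- Passing to minimal residues modulo a random `u`-set at least halves the average size. -/
theorem sum_card_residue_le {α ι : Type*} [DecidableEq α] [Fintype ι]
    (A : Finset α) (T : ι → Finset α) (hTA : ∀ y, T y ⊆ A) (hT : ∀ y, (T y).Nonempty)
    (u : ℕ) (hu : 0 < u) (r : ℝ) (hr : 0 < r) (hru : 256 * (A.card : ℝ) ≤ r * u)
    (hspread : ∀ Z : Finset α,
      ((Finset.univ.filter fun y => Z ⊆ T y).card : ℝ) * r ^ Z.card ≤ Fintype.card ι)
    (R : Finset α → ι → Finset α) (hR : ∀ U y, R U y ⊆ T y)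
    (hRj : ∀ U y, ∃ j, (T j).card ≤ (T y).card ∧ R U y = T j \ U)
    (hRmin : ∀ U y j, (T j).card ≤ (T y).card → T j ⊆ R U y ∪ U → R U y ⊆ T j) :
    ∑ U ∈ A.powersetCard u, ∑ y, ((R U y).card : ℝ)
      ≤ (A.card.choose u : ℝ) * (∑ y, ((T y).card : ℝ)) / 2 := by
  classical
  set M : ℝ := (A.card.choose u : ℝ) with hM
  set L : ℝ := (Fintype.card ι : ℝ) with hL
  set P := (A.powersetCard u) ×ˢ (Finset.univ : Finset ι) with hP
  have hu' : (0 : ℝ) < u := by exact_mod_cast hu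
  -- the number of pairs with prescribed sizes
  have hpairs : ∀ s t : ℕ,
      ((P.filter fun p => (T p.2).card = s ∧ (R p.1 p.2).card = t).card : ℝ)
        ≤ M * L * 2 ^ s / 256 ^ t := by
    intro s t
    have h := card_residue_pairs_le A T hTA u s t R hR hRj hRmin (L / r ^ t) (by positivity)
      (fun Z hZ => by
        rw [le_div_iff₀ (by positivity), ← hZ]
        exact hspread Z)
    refine h.trans ?_
    have hchoose : (A.card.choose (u + t) : ℝ) * (u : ℝ) ^ t ≤ M * (A.card : ℝ) ^ t := by
      rw [hM]
      exact_mod_cast choose_add_mul_pow_le A.card u t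
    have hpow : (256 * (A.card : ℝ)) ^ t ≤ (r * u) ^ t :=
      pow_le_pow_left₀ (by positivity) hru t
    have hratio : (A.card.choose (u + t) : ℝ) * 256 ^ t ≤ M * r ^ t := by
      refine le_of_mul_le_mul_right ?_ (pow_pos hu' t)
      calc (A.card.choose (u + t) : ℝ) * 256 ^ t * (u : ℝ) ^ t
          = (A.card.choose (u + t) : ℝ) * (u : ℝ) ^ t * 256 ^ t := by ring
        _ ≤ M * (A.card : ℝ) ^ t * 256 ^ t := by gcongr
        _ = M * (256 * (A.card : ℝ)) ^ t := by rw [mul_pow]; ring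
        _ ≤ M * (r * u) ^ t := by gcongr
        _ = M * r ^ t * (u : ℝ) ^ t := by rw [mul_pow]; ring
    calc (A.card.choose (u + t) : ℝ) * (2 ^ s * (L / r ^ t))
        = (A.card.choose (u + t) : ℝ) * 256 ^ t * (2 ^ s * L / (r ^ t * 256 ^ t)) := by
          field_simp
      _ ≤ M * r ^ t * (2 ^ s * L / (r ^ t * 256 ^ t)) := by gcongr
      _ = M * L * 2 ^ s / 256 ^ t := by field_simp
  -- each pair has a small residue or is counted by its sizes
  have hpoint : ∀ p ∈ P, ((R p.1 p.2).card : ℝ) ≤ ((T p.2).card : ℝ) / 4 +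
      ∑ t ∈ Finset.range A.card, ∑ s ∈ Finset.range (4 * (t + 1)),
        if (T p.2).card = s ∧ (R p.1 p.2).card = t + 1 then ((t : ℝ) + 1) else 0 := by
    rintro ⟨U, y⟩ -
    have hnonneg : ∀ t ∈ Finset.range A.card, (0 : ℝ) ≤ ∑ s ∈ Finset.range (4 * (t + 1)),
        if (T y).card = s ∧ (R U y).card = t + 1 then ((t : ℝ) + 1) else 0 := fun t _ =>
      Finset.sum_nonneg fun s _ => by split_ifs <;> positivity
    by_cases h : 4 * (R U y).card ≤ (T y).card
    · have h' : 4 * ((R U y).card : ℝ) ≤ (T y).card := by exact_mod_cast h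
      have := Finset.sum_nonneg hnonneg
      dsimp only
      linarith
    · obtain ⟨t, ht⟩ : ∃ t, (R U y).card = t + 1 := ⟨(R U y).card - 1, by omega⟩
      have htA : t ∈ Finset.range A.card := by
        have := Finset.card_le_card ((hR U y).trans (hTA y))
        rw [Finset.mem_range]; omega
      have h₁ := Finset.single_le_sum hnonneg htA
      rw [Finset.sum_eq_single_of_mem (T y).card (by rw [Finset.mem_range]; omega)
        (fun s _ hs => if_neg fun h => hs h.1.symm), if_pos ⟨rfl, ht⟩] at h₁
      have h₂ : (0 : ℝ) ≤ ((T y).card : ℝ) / 4 := by positivity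
      have h₃ : ((R U y).card : ℝ) = t + 1 := by exact_mod_cast ht
      dsimp only
      linarith
  have hterm : ∀ t : ℕ, ∑ s ∈ Finset.range (4 * (t + 1)),
      ((t : ℝ) + 1) * (M * L * 2 ^ s / 256 ^ (t + 1)) ≤ M * L / 8 * (1 / 2) ^ t := by
    intro t
    have hgeom : ∑ s ∈ Finset.range (4 * (t + 1)), (2 : ℝ) ^ s ≤ 16 ^ (t + 1) := by
      rw [geom_sum_eq (by norm_num), pow_mul]
      norm_num
    have ht : (t : ℝ) + 1 ≤ 2 ^ t := by exact_mod_cast Nat.lt_two_pow_self (n := t)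
    calc ∑ s ∈ Finset.range (4 * (t + 1)), ((t : ℝ) + 1) * (M * L * 2 ^ s / 256 ^ (t + 1))
        = ((t : ℝ) + 1) * (M * L / 256 ^ (t + 1)) *
            ∑ s ∈ Finset.range (4 * (t + 1)), (2 : ℝ) ^ s := by
          rw [Finset.mul_sum]
          exact Finset.sum_congr rfl fun s _ => by ring
      _ ≤ 2 ^ t * (M * L / 256 ^ (t + 1)) * 16 ^ (t + 1) := by gcongr
      _ = M * L / 16 * (1 / 8) ^ t := by
          have h₁ : (256 : ℝ) ^ (t + 1) = 16 * 16 ^ (t + 1) * (2 ^ t * 8 ^ t) := by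
            rw [← mul_pow, pow_succ, pow_succ, show (256 : ℝ) = 16 * 16 by norm_num, mul_pow]
            norm_num
            ring
          rw [h₁, one_div, inv_pow]
          field_simp
      _ ≤ M * L / 8 * (1 / 2) ^ t := by gcongr <;> norm_num
  have hLT : L ≤ ∑ y, ((T y).card : ℝ) := by
    calc L = ∑ _y : ι, (1 : ℝ) := by simp [hL]
      _ ≤ _ := Finset.sum_le_sum fun y _ => by exact_mod_cast (hT y).card_pos
  rw [← Finset.sum_product']
  calc ∑ p ∈ P, ((R p.1 p.2).card : ℝ)
      ≤ ∑ p ∈ P, (((T p.2).card : ℝ) / 4 +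
        ∑ t ∈ Finset.range A.card, ∑ s ∈ Finset.range (4 * (t + 1)),
          if (T p.2).card = s ∧ (R p.1 p.2).card = t + 1 then ((t : ℝ) + 1) else 0) :=
        Finset.sum_le_sum hpoint
    _ = M * (∑ y, ((T y).card : ℝ)) / 4 +
        ∑ t ∈ Finset.range A.card, ∑ s ∈ Finset.range (4 * (t + 1)), ((t : ℝ) + 1) *
          ((P.filter fun p => (T p.2).card = s ∧ (R p.1 p.2).card = t + 1).card : ℝ) := by
        rw [Finset.sum_add_distrib]
        congr 1
        · rw [hP, Finset.sum_product]
          simp [← Finset.sum_div, hM, mul_div_assoc]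
        · rw [Finset.sum_comm]
          refine Finset.sum_congr rfl fun t _ => ?_
          rw [Finset.sum_comm]
          refine Finset.sum_congr rfl fun s _ => ?_
          rw [← Finset.sum_filter, Finset.sum_const, nsmul_eq_mul, mul_comm]
    _ ≤ M * (∑ y, ((T y).card : ℝ)) / 4 +
        ∑ t ∈ Finset.range A.card, M * L / 8 * (1 / 2) ^ t := by
        gcongr with t ht
        refine le_trans (Finset.sum_le_sum fun s _ => ?_) (hterm t)
        gcongr
        exact hpairs s (t + 1)
    _ ≤ M * (∑ y, ((T y).card : ℝ)) / 4 + M * (∑ y, ((T y).card : ℝ)) / 4 := by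
        gcongr
        rw [← Finset.mul_sum]
        have hgeom : ∑ t ∈ Finset.range A.card, ((1 : ℝ) / 2) ^ t ≤ 2 := by
          exact sum_geometric_two_le A.card
        calc M * L / 8 * ∑ t ∈ Finset.range A.card, ((1 : ℝ) / 2) ^ t
            ≤ M * (∑ y, ((T y).card : ℝ)) / 8 * 2 := by gcongr
          _ = _ := by ring
    _ = _ := by ring

/-- Choosing a `w`-set as a `u`-set `U` followed by a `(w - u)`-set `V` outside `U`. -/
theorem card_filter_powersetCard_mul_choose_le {α : Type*} [DecidableEq α]
    (A : Finset α) (u w : ℕ) (p : Finset α → Prop) [DecidablePred p] :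
    ((A.powersetCard w).filter p).card * w.choose u ≤
      ∑ U ∈ A.powersetCard u,
        (((A \ U).powersetCard (w - u)).filter fun V => p (U ∪ V)).card := by
  calc ((A.powersetCard w).filter p).card * w.choose u
      = (((A.powersetCard w).filter p).sigma fun W => W.powersetCard u).card := by
        rw [Finset.card_sigma, ← smul_eq_mul]
        refine (Finset.sum_eq_card_nsmul fun W hW => ?_).symm
        rw [Finset.card_powersetCard,
          (Finset.mem_powersetCard.1 (Finset.mem_filter.1 hW).1).2]
    _ ≤ ((A.powersetCard u).sigma fun U =>
          ((A \ U).powersetCard (w - u)).filter fun V => p (U ∪ V)).card := by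
        refine Finset.card_le_card_of_injOn (fun x => ⟨x.2, x.1 \ x.2⟩) ?_ ?_
        · rintro ⟨W, U⟩ h
          simp only [Finset.coe_sigma, Set.mem_sigma_iff, Finset.mem_coe, Finset.mem_filter,
            Finset.mem_powersetCard] at h ⊢
          obtain ⟨⟨⟨hWA, hWw⟩, hW⟩, hUW, hUu⟩ := h
          refine ⟨⟨hUW.trans hWA, hUu⟩, ⟨Finset.sdiff_subset_sdiff hWA le_rfl, ?_⟩, ?_⟩
          · rw [Finset.card_sdiff_of_subset hUW, hWw, hUu]
          · rwa [Finset.union_sdiff_of_subset hUW]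
        · rintro ⟨W, U⟩ h ⟨W', U'⟩ h' heq
          simp only [Finset.coe_sigma, Set.mem_sigma_iff, Finset.mem_coe, Finset.mem_filter,
            Finset.mem_powersetCard] at h h'
          simp only [Sigma.mk.injEq, heq_eq_eq] at heq
          obtain ⟨rfl, h₂⟩ := heq
          have : W = W' := by
            rw [← Finset.union_sdiff_of_subset h.2.1, h₂, Finset.union_sdiff_of_subset h'.2.1]
          rw [this]
    _ = _ := Finset.card_sigma _ _

/-- The number of `w`-sets that contain no member of a spread family, after `m` rounds of
exposing `u` elements. -/
theorem card_avoiding_mul_two_pow_le {α ι : Type*} [DecidableEq α] [Fintype ι]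
    (u : ℕ) (hu : 0 < u) (r : ℝ) (hr : 0 < r) (m : ℕ) :
    ∀ (A : Finset α) (T : ι → Finset α) (w : ℕ), (∀ y, T y ⊆ A) →
      256 * (A.card : ℝ) ≤ r * u → m * u ≤ w → w ≤ A.card →
      (∀ Z : Finset α,
        ((Finset.univ.filter fun y => Z ⊆ T y).card : ℝ) * r ^ Z.card ≤ Fintype.card ι) →
      (((A.powersetCard w).filter fun W => ∀ y, ¬ T y ⊆ W).card : ℝ) *
          Fintype.card ι * 2 ^ m
        ≤ (A.card.choose w : ℝ) * ∑ y, ((T y).card : ℝ) := by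
  induction m with
  | zero =>
    intro A T w _ _ _ _ _
    by_cases hT : ∀ y, (T y).Nonempty
    · rw [pow_zero, mul_one]
      gcongr
      · rw [← Finset.card_powersetCard]
        exact Finset.card_filter_le _ _
      · calc (Fintype.card ι : ℝ) = ∑ _y : ι, (1 : ℝ) := by simp
          _ ≤ _ := Finset.sum_le_sum fun y _ => by exact_mod_cast (hT y).card_pos
    · push Not at hT
      obtain ⟨y, hy⟩ := hT
      rw [Finset.filter_false_of_mem fun W _ h => h y (by simp [hy])]
      simp only [Finset.card_empty, Nat.cast_zero, zero_mul]
      positivity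
  | succ m ih =>
    intro A T w hTA hru hmw hwA hspread
    by_cases hT : ∀ y, (T y).Nonempty
    · choose R hR hRj hRmin using fun U => exists_minimal_residue T U
      have huw : u ≤ w := by nlinarith
      have hround : ∀ U ∈ A.powersetCard u,
          ((((A \ U).powersetCard (w - u)).filter fun V => ∀ y, ¬ T y ⊆ U ∪ V).card : ℝ) *
            Fintype.card ι * 2 ^ m
          ≤ ((A.card - u).choose (w - u) : ℝ) * ∑ y, ((R U y).card : ℝ) := by
        intro U hU
        obtain ⟨hUA, hUu⟩ := Finset.mem_powersetCard.1 hU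
        have hcard : (A \ U).card = A.card - u := by
          rw [Finset.card_sdiff_of_subset hUA, hUu]
        have h := ih (A \ U) (R U) (w - u) (fun y => ?_) ?_ ?_ ?_ fun Z => ?_
        · rw [hcard] at h
          refine le_trans ?_ h
          gcongr ((Finset.card ?_ : ℕ) : ℝ) * _ * _
          refine Finset.monotone_filter_right _ fun V _ hV y hy => ?_
          obtain ⟨j, -, hj⟩ := hRj U y
          rw [hj] at hy
          exact hV j (sdiff_le_iff.1 hy)
        · obtain ⟨j, -, hj⟩ := hRj U y
          rw [hj]
          exact Finset.sdiff_subset_sdiff (hTA j) le_rfl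
        · refine le_trans ?_ hru
          gcongr
          exact Finset.sdiff_subset
        · rw [add_mul, one_mul] at hmw
          omega
        · omega
        · refine le_trans ?_ (hspread Z)
          gcongr ((Finset.card ?_ : ℕ) : ℝ) * _
          exact Finset.monotone_filter_right _ fun y _ hZ => hZ.trans (hR U y)
      have hsum := sum_card_residue_le A T hTA hT u hu r hr hru hspread R hR hRj hRmin
      have hsplit := card_filter_powersetCard_mul_choose_le A u w fun W => ∀ y, ¬ T y ⊆ W
      have hsplit' : (((A.powersetCard w).filter fun W => ∀ y, ¬ T y ⊆ W).card : ℝ) *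
          (w.choose u : ℝ) ≤ ∑ U ∈ A.powersetCard u,
            ((((A \ U).powersetCard (w - u)).filter fun V => ∀ y, ¬ T y ⊆ U ∪ V).card : ℝ) := by
        exact_mod_cast hsplit
      have hchoose : (A.card.choose w : ℝ) * (w.choose u : ℝ)
          = (A.card.choose u : ℝ) * ((A.card - u).choose (w - u) : ℝ) := by
        exact_mod_cast Nat.choose_mul huw
      have hpos : (0 : ℝ) < w.choose u := by exact_mod_cast Nat.choose_pos huw
      refine le_of_mul_le_mul_right ?_ hpos
      calc (((A.powersetCard w).filter fun W => ∀ y, ¬ T y ⊆ W).card : ℝ) *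
            Fintype.card ι * 2 ^ (m + 1) * (w.choose u : ℝ)
          = (((A.powersetCard w).filter fun W => ∀ y, ¬ T y ⊆ W).card : ℝ) *
            (w.choose u : ℝ) * (Fintype.card ι * 2 ^ m * 2) := by ring
        _ ≤ (∑ U ∈ A.powersetCard u,
            ((((A \ U).powersetCard (w - u)).filter fun V => ∀ y, ¬ T y ⊆ U ∪ V).card : ℝ)) *
            (Fintype.card ι * 2 ^ m * 2) := by gcongr
        _ = (∑ U ∈ A.powersetCard u,
            ((((A \ U).powersetCard (w - u)).filter fun V => ∀ y, ¬ T y ⊆ U ∪ V).card : ℝ) *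
              Fintype.card ι * 2 ^ m) * 2 := by
            rw [Finset.sum_mul, Finset.sum_mul]
            exact Finset.sum_congr rfl fun U _ => by ring
        _ ≤ (∑ U ∈ A.powersetCard u,
            ((A.card - u).choose (w - u) : ℝ) * ∑ y, ((R U y).card : ℝ)) * 2 := by
            gcongr ?_ * 2
            exact Finset.sum_le_sum hround
        _ = ((A.card - u).choose (w - u) : ℝ) * 2 *
            ∑ U ∈ A.powersetCard u, ∑ y, ((R U y).card : ℝ) := by
            rw [← Finset.mul_sum]; ring
        _ ≤ ((A.card - u).choose (w - u) : ℝ) * 2 *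
            ((A.card.choose u : ℝ) * (∑ y, ((T y).card : ℝ)) / 2) := by gcongr
        _ = (A.card.choose u : ℝ) * ((A.card - u).choose (w - u) : ℝ) *
            ∑ y, ((T y).card : ℝ) := by ring
        _ = _ := by rw [← hchoose]; ring
    · push Not at hT
      obtain ⟨y, hy⟩ := hT
      rw [Finset.filter_false_of_mem fun W _ h => h y (by simp [hy])]
      simp only [Finset.card_empty, Nat.cast_zero, zero_mul]
      positivity

/-- An `r`-spread family of at least `r ^ k` sets of size `k` has a ground set of size at
least `r`. -/
theorem le_card_of_spread {α ι : Type*} [Fintype α] [DecidableEq α] [Fintype ι]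
    (S : ι → Finset α) (k : ℕ) (hk : 0 < k) (r : ℝ) (hr : 0 < r)
    (hS : ∀ i, (S i).card = k)
    (hspread : ∀ x, ((Finset.univ.filter fun i => x ∈ S i).card : ℝ) ≤ r ^ (k - 1))
    (hcard : r ^ k ≤ Fintype.card ι) : r ≤ Fintype.card α := by
  have hcount : ∑ i, (S i).card = ∑ x, (Finset.univ.filter fun i => x ∈ S i).card := by
    have := Finset.sum_card_bipartiteAbove_eq_sum_card_bipartiteBelow
      (s := (Finset.univ : Finset ι)) (t := (Finset.univ : Finset α)) (fun i x => x ∈ S i)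
    simpa [Finset.bipartiteAbove, Finset.bipartiteBelow] using this
  have hupper : ((Fintype.card ι * k : ℕ) : ℝ) ≤ Fintype.card α * r ^ (k - 1) := by
    calc ((Fintype.card ι * k : ℕ) : ℝ) = ((∑ i, (S i).card : ℕ) : ℝ) := by simp [hS]
      _ = ∑ x, ((Finset.univ.filter fun i => x ∈ S i).card : ℝ) := by
          rw [hcount]; push_cast; rfl
      _ ≤ ∑ _x : α, r ^ (k - 1) := Finset.sum_le_sum fun x _ => hspread x
      _ = _ := by simp
  have hk' : (1 : ℝ) ≤ k := by exact_mod_cast hk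
  refine le_of_mul_le_mul_right ?_ (pow_pos hr (k - 1))
  calc r * r ^ (k - 1) = r ^ k := by rw [← pow_succ', Nat.sub_add_cancel hk]
    _ ≤ Fintype.card ι := hcard
    _ ≤ Fintype.card ι * k := le_mul_of_one_le_right (by positivity) hk'
    _ ≤ _ := by exact_mod_cast hupper

/-- **Random sets contain a set of an `r`-spread family** (part of Lemma 3 of the paper).
There is a universal constant `β > 1` such that: for `0 < γ < 1/2`, `0 < ε < 1/2`,
positive integers `k, n`, and `r = β * (1/γ) * log₂ (k/ε)`, if `S : Fin ℓ → Finset (Fin n)`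
is an `r`-spread sequence of at least `r ^ k` sets of size exactly `k`, and `W ⊆ [n]` is a
uniformly random set of a fixed size `w ≥ γ * n`, then
`Pr[∃ y, S y ⊆ W] > 1 - ε`. The probability is expressed as a ratio of counts over all
`w`-element subsets of `Fin n`. -/
theorem random_set_contains_spread_set :
    ∃ β : ℝ, 1 < β ∧
      ∀ (γ ε r : ℝ) (k n ℓ : ℕ) (S : Fin ℓ → Finset (Fin n)),
        0 < γ → γ < 1/2 → 0 < ε → ε < 1/2 → 0 < k → 0 < n →
        r = β * (1/γ) * Real.logb 2 (k / ε) →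
        (∀ i, (S i).card = k) →
        -- the sequence is r-spread
        (∀ Z : Finset (Fin n), Z.Nonempty →
          (((Finset.univ.filter (fun i : Fin ℓ => Z ⊆ S i)).card : ℝ) ≤ r ^ (k - Z.card))) →
        -- at least r ^ k sets
        r ^ k ≤ (ℓ : ℝ) →
        ∀ w : ℕ, γ * n ≤ (w : ℝ) → w ≤ n →
          1 - ε <
            (((Finset.powersetCard w (Finset.univ : Finset (Fin n))).filter
                (fun W => ∃ y : Fin ℓ, S y ⊆ W)).card : ℝ) /
              ((Finset.powersetCard w (Finset.univ : Finset (Fin n))).card : ℝ) := by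
  refine ⟨1024, by norm_num, ?_⟩
  intro γ ε r k n ℓ S hγ _ hε hε' hk _ hr hS hspread hℓ w hw hwn
  set L : ℝ := Real.logb 2 (k / ε) with hL
  have hk' : (1 : ℝ) ≤ k := by exact_mod_cast hk
  have hkε : 2 ≤ (k : ℝ) / ε := by
    rw [le_div_iff₀ hε]; linarith
  have hL₁ : 1 ≤ L := by
    rw [hL, Real.le_logb_iff_rpow_le (by norm_num) (by positivity)]
    simpa using hkε
  have hr_pos : 0 < r := by rw [hr]; positivity
  have hγr : γ * r = 1024 * L := by rw [hr]; field_simp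
  obtain ⟨m, hm⟩ : ∃ m : ℕ, m = ⌊L⌋₊ + 1 := ⟨_, rfl⟩
  have hm_pos : 0 < m := by omega
  have hm_gt : L < m := by rw [hm]; exact_mod_cast Nat.lt_floor_add_one L
  have hm_le : (m : ℝ) ≤ 2 * L := by
    have := Nat.floor_le (zero_le_one.trans hL₁)
    rw [hm]; push_cast; linarith
  have hrn : r ≤ n := by
    simpa using le_card_of_spread S k hk r hr_pos hS
      (fun x => by simpa using hspread {x} (by simp)) (by simpa using hℓ)
  have hmw : m ≤ w := by
    have : γ * r ≤ γ * n := by gcongr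
    have : (m : ℝ) ≤ w := by linarith
    exact_mod_cast this
  obtain ⟨u, hu⟩ : ∃ u : ℕ, u = w / m := ⟨_, rfl⟩
  have hu_pos : 0 < u := hu ▸ Nat.div_pos hmw hm_pos
  have hmu : m * u ≤ w := hu ▸ Nat.mul_div_le w m
  have hw_le : (w : ℝ) ≤ 4 * L * u := by
    have h : w ≤ m * (2 * u) := by
      have := Nat.lt_mul_div_succ w hm_pos
      rw [← hu] at this
      nlinarith
    calc (w : ℝ) ≤ m * (2 * u) := by exact_mod_cast h
      _ ≤ 2 * L * (2 * u) := by gcongr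
      _ = _ := by ring
  have hru : 256 * (n : ℝ) ≤ r * u := by
    refine le_of_mul_le_mul_left ?_ hγ
    calc γ * (256 * (n : ℝ)) = 256 * (γ * n) := by ring
      _ ≤ 256 * (4 * L * u) := mul_le_mul_of_nonneg_left (hw.trans hw_le) (by norm_num)
      _ = γ * r * u := by rw [hγr]; ring
      _ = _ := by ring
  have hbad := card_avoiding_mul_two_pow_le u hu_pos r hr_pos m Finset.univ S w
    (fun y => Finset.subset_univ _) (by simpa using hru) hmu (by simpa using hwn) (fun Z => by
      rw [Fintype.card_fin]
      rcases Z.eq_empty_or_nonempty with rfl | hZ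
      · simp
      by_cases hZk : Z.card ≤ k
      · calc _ ≤ r ^ (k - Z.card) * r ^ Z.card := by gcongr; exact hspread Z hZ
          _ = r ^ k := by rw [← pow_add, Nat.sub_add_cancel hZk]
          _ ≤ ℓ := hℓ
      · rw [Finset.filter_false_of_mem fun i _ h => hZk ((Finset.card_le_card h).trans (hS i).le)]
        simp)
  have hℓ_pos : (0 : ℝ) < ℓ := (pow_pos hr_pos k).trans_le hℓ
  set total := (Finset.powersetCard w (Finset.univ : Finset (Fin n))).card with htotal
  have htotal_eq : total = n.choose w := by simp [htotal]
  have htotal_pos : (0 : ℝ) < total := by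
    rw [htotal_eq]; exact_mod_cast Nat.choose_pos hwn
  have hcompl := Finset.card_filter_add_card_filter_not
    (s := Finset.powersetCard w (Finset.univ : Finset (Fin n))) (fun W => ∃ y : Fin ℓ, S y ⊆ W)
  simp only [not_exists] at hcompl
  set bad := ((Finset.powersetCard w (Finset.univ : Finset (Fin n))).filter
    fun W => ∀ y : Fin ℓ, ¬ S y ⊆ W).card with hbad_def
  simp only [Fintype.card_fin, Finset.card_univ, hS, Finset.sum_const, nsmul_eq_mul] at hbad
  rw [← htotal_eq] at hbad
  have hpow : (k : ℝ) < ε * 2 ^ m := by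
    rw [hL, Real.logb_lt_iff_lt_rpow (by norm_num) (by positivity), Real.rpow_natCast,
      div_lt_iff₀ hε] at hm_gt
    linarith
  have hbad_lt : (bad : ℝ) < ε * total := by
    have h₁ : (bad : ℝ) * 2 ^ m ≤ total * k := by
      refine le_of_mul_le_mul_right ?_ hℓ_pos
      calc (bad : ℝ) * 2 ^ m * ℓ = bad * ℓ * 2 ^ m := by ring
        _ ≤ total * (ℓ * k) := by convert hbad
        _ = _ := by ring
    refine lt_of_mul_lt_mul_right (a := (2 : ℝ) ^ m) ?_ (by positivity)
    calc (bad : ℝ) * 2 ^ m ≤ total * k := h₁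
      _ < total * (ε * 2 ^ m) := by gcongr
      _ = _ := by ring
  rw [lt_div_iff₀ htotal_pos]
  have hcompl' := congrArg (Nat.cast (R := ℝ)) hcompl
  push_cast at hcompl'
  linarith
end

section
/- There is a universal constant β > 1 such that the following holds. Let 0 < γ < 1/2 and 0 < ε < 1/2, let k, n be positive integers, and set r = β · (1/γ) · log₂(k/ε). Suppose S_1, …, S_ℓ ⊆ [n] is an r-spread sequence of at least r^k sets, each of size exactly k. Let X be uniformly distributed on [ℓ] and let W ⊆ [n] be a uniformly random set of a fixed size that is at least γn, independent of X. Then E[f(X, W)] < ε. -/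
/-- `f x W = min { |S y \ W| : y, S y ⊆ S x ∪ W }`.  The set of candidate values is
nonempty since `y = x` always qualifies, so `Nat.sInf` is this minimum. -/
noncomputable def chiCard {n ℓ : ℕ} (S : Fin ℓ → Finset (Fin n)) (x : Fin ℓ) (W : Finset (Fin n)) : ℕ :=
  sInf {m : ℕ | ∃ y : Fin ℓ, S y ⊆ S x ∪ W ∧ (S y \ W).card = m}

/-- The smallest residue `|T y \ W|` among the indices `y` with `T y ⊆ T x ∪ W`. -/
noncomputable def minResidue {α ι : Type*} [DecidableEq α] (T : ι → Finset α) (x : ι)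
    (W : Finset α) : ℕ :=
  sInf {m : ℕ | ∃ y : ι, T y ⊆ T x ∪ W ∧ (T y \ W).card = m}

lemma minResidue_le {α ι : Type*} [DecidableEq α] (T : ι → Finset α) (x y : ι)
    (W : Finset α) (h : T y ⊆ T x ∪ W) : minResidue T x W ≤ (T y \ W).card :=
  Nat.sInf_le ⟨y, h, rfl⟩

lemma exists_minResidue {α ι : Type*} [DecidableEq α] (T : ι → Finset α) (x : ι)
    (W : Finset α) : ∃ y, T y ⊆ T x ∪ W ∧ (T y \ W).card = minResidue T x W :=
  Nat.sInf_mem (s := {m : ℕ | ∃ y : ι, T y ⊆ T x ∪ W ∧ (T y \ W).card = m})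
    ⟨_, x, Finset.subset_union_left, rfl⟩

lemma choose_add_mul_pow_le_s3 (g v m : ℕ) :
    g.choose (v + m) * v ^ m ≤ g.choose v * g ^ m := by
  induction m with
  | zero => simp
  | succ m ih =>
    have h := Nat.choose_succ_right_eq g (v + m)
    calc g.choose (v + (m + 1)) * v ^ (m + 1)
        = g.choose (v + m + 1) * v * v ^ m := by rw [← add_assoc]; ring
      _ ≤ g.choose (v + m + 1) * (v + m + 1) * v ^ m := by gcongr; omega
      _ = g.choose (v + m) * v ^ m * (g - (v + m)) := by rw [h]; ring
      _ ≤ g.choose v * g ^ m * g := by gcongr; omega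
      _ = g.choose v * g ^ (m + 1) := by ring

/-- Choosing a `w`-subset of `G` together with a `v`-subset of it amounts to choosing a `v`-subset
of `G` and then a `(w - v)`-subset of its complement. -/
lemma sum_powersetCard_union {α : Type*} [DecidableEq α] (G : Finset α) {v w : ℕ} (hvw : v ≤ w)
    (h : Finset α → ℝ) :
    ∑ V ∈ G.powersetCard v, ∑ W ∈ (G \ V).powersetCard (w - v), h (V ∪ W) =
      (w.choose v : ℝ) * ∑ W ∈ G.powersetCard w, h W := by
  have h1 : (w.choose v : ℝ) * ∑ W ∈ G.powersetCard w, h W =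
      ∑ W ∈ G.powersetCard w, ∑ _V ∈ W.powersetCard v, h W := by
    rw [Finset.mul_sum]
    refine Finset.sum_congr rfl fun W hW => ?_
    rw [Finset.sum_const, Finset.card_powersetCard, (Finset.mem_powersetCard.1 hW).2, nsmul_eq_mul]
  rw [h1, Finset.sum_sigma', Finset.sum_sigma']
  refine Finset.sum_bij' (fun p _ => ⟨p.1 ∪ p.2, p.1⟩) (fun p _ => ⟨p.2, p.1 \ p.2⟩) ?_ ?_ ?_ ?_ ?_
  · rintro ⟨V, W⟩ hp
    simp only [Finset.mem_sigma, Finset.mem_powersetCard] at hp ⊢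
    obtain ⟨⟨hV, hVc⟩, hW, hWc⟩ := hp
    have hd : Disjoint V W := (Finset.disjoint_of_subset_left hW Finset.sdiff_disjoint).symm
    refine ⟨⟨Finset.union_subset hV (hW.trans Finset.sdiff_subset), ?_⟩,
      Finset.subset_union_left, hVc⟩
    rw [Finset.card_union_of_disjoint hd]; omega
  · rintro ⟨W, V⟩ hp
    simp only [Finset.mem_sigma, Finset.mem_powersetCard] at hp ⊢
    obtain ⟨⟨hW, hWc⟩, hV, hVc⟩ := hp
    refine ⟨⟨hV.trans hW, hVc⟩, Finset.sdiff_subset_sdiff hW subset_rfl, ?_⟩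
    rw [Finset.card_sdiff_of_subset hV]; omega
  · rintro ⟨V, W⟩ hp
    simp only [Finset.mem_sigma, Finset.mem_powersetCard] at hp
    have hd : Disjoint V W := (Finset.disjoint_of_subset_left hp.2.1 Finset.sdiff_disjoint).symm
    simp [Finset.union_sdiff_cancel_left hd]
  · rintro ⟨W, V⟩ hp
    simp only [Finset.mem_sigma, Finset.mem_powersetCard] at hp
    simp [Finset.union_sdiff_of_subset hp.2.1]
  · rintro ⟨V, W⟩ _
    rfl

/-- A random index whose set is `T` is `R`-spread: `P(Z ⊆ T) ≤ R ^ (-|Z|)` for all `Z`. -/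
def IsSpread {α ι : Type*} [DecidableEq α] [Fintype ι] (R : ℝ) (T : ι → Finset α) : Prop :=
  ∀ Z : Finset α,
    ((Finset.univ.filter fun i => Z ⊆ T i).card : ℝ) * R ^ Z.card ≤ Fintype.card ι

lemma IsSpread.mono {α ι : Type*} [DecidableEq α] [Fintype ι] {R : ℝ} (hR : 0 ≤ R)
    {T T' : ι → Finset α} (hT : IsSpread R T) (h : ∀ x, T' x ⊆ T x) : IsSpread R T' := by
  intro Z
  refine le_trans ?_ (hT Z)
  have hsub : (Finset.univ.filter fun i => Z ⊆ T' i) ⊆ Finset.univ.filter fun i => Z ⊆ T i :=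
    Finset.monotone_filter_right _ fun i _ hZ => hZ.trans (h i)
  gcongr

/-- If `φ x V` is the least residue `|T y \ V|` over `T y ⊆ T x ∪ V` with `|T y| ≤ |T x|`, then few
pairs `(x, V)` have `φ x V = m > |T x| / 4`.  The pair is recovered from `x`, the union `U` of `V`
with a minimal residue `F`, and `F` itself, which lies in a smallest member of the family inside
`U`. -/
lemma card_large_residue_mul_le {α ι : Type*} [DecidableEq α] [Fintype ι] {R : ℝ} (hR : 0 < R)
    {T : ι → Finset α} (hT : IsSpread R T) {G : Finset α} (hG : ∀ x, T x ⊆ G) (hg : 0 < G.card)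
    {v : ℕ} (hv : 256 * (G.card : ℝ) ≤ R * v) (Y : ι → Finset α → ι)
    (hY : ∀ x V, T (Y x V) ⊆ T x ∪ V) (hYc : ∀ x V, (T (Y x V)).card ≤ (T x).card)
    (hmin : ∀ x V y, T y ⊆ T x ∪ V → (T y).card ≤ (T x).card →
      (T (Y x V) \ V).card ≤ (T y \ V).card) (m : ℕ) :
    (((Finset.univ ×ˢ G.powersetCard v).filter fun p : ι × Finset α =>
      (T (Y p.1 p.2) \ p.2).card = m ∧ (T p.1).card < 4 * m).card : ℝ) * 16 ^ m ≤
      (G.card.choose v : ℝ) * Fintype.card ι := by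
  classical
  set B := (Finset.univ ×ˢ G.powersetCard v).filter fun p : ι × Finset α =>
      (T (Y p.1 p.2) \ p.2).card = m ∧ (T p.1).card < 4 * m with hB
  have hP : ∀ U : Finset α, ∃ P : Finset α, ∀ y, T y ⊆ U →
      ∃ z, T z = P ∧ P ⊆ U ∧ P.card ≤ (T y).card := by
    intro U
    by_cases hU : (Finset.univ.filter fun y => T y ⊆ U).Nonempty
    · obtain ⟨z, hz, hzm⟩ := Finset.exists_min_image _ (fun y => (T y).card) hU
      refine ⟨T z, fun y hy => ⟨z, rfl, (Finset.mem_filter.1 hz).2, hzm y ?_⟩⟩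
      simpa using hy
    · exact ⟨∅, fun y hy => absurd ⟨y, by simpa using hy⟩ hU⟩
  choose P hP using hP
  let Q : Finset α → Finset (Finset α) := fun U =>
    if (P U).card ≤ 4 * m then (P U).powersetCard m else ∅
  have hsub : B ⊆ (G.powersetCard (v + m)).biUnion fun U => (Q U).biUnion fun F =>
      (Finset.univ.filter fun x => F ⊆ T x).image fun x => (x, U \ F) := by
    rintro ⟨x, V⟩ hp
    simp only [hB, Finset.mem_filter, Finset.mem_product, Finset.mem_univ, true_and,
      Finset.mem_powersetCard] at hp
    obtain ⟨⟨hVG, hVc⟩, hm, hs⟩ := hp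
    set F := T (Y x V) \ V with hF
    have hFx : F ⊆ T x := by
      intro a ha
      obtain ⟨ha1, ha2⟩ := Finset.mem_sdiff.1 ha
      exact (Finset.mem_union.1 (hY x V ha1)).resolve_right ha2
    have hd : Disjoint V F := Finset.disjoint_sdiff
    obtain ⟨z, hz, hzU, hzc⟩ := hP (V ∪ F) (Y x V) (by
      intro a ha; by_cases haV : a ∈ V <;> simp [hF, ha, haV])
    have hzx : (T z).card ≤ (T x).card := hz ▸ hzc.trans (hYc x V)
    have hzs : T z ⊆ T x ∪ V := by
      rw [hz, Finset.union_comm (T x)]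
      exact hzU.trans (Finset.union_subset_union subset_rfl hFx)
    have hzF : T z \ V ⊆ F := by
      rw [hz]
      intro a ha
      obtain ⟨ha1, ha2⟩ := Finset.mem_sdiff.1 ha
      exact (Finset.mem_union.1 (hzU ha1)).resolve_left ha2
    have hEq : T z \ V = F := Finset.eq_of_subset_of_card_le hzF (hmin x V z hzs hzx)
    have hFP : F ⊆ P (V ∪ F) := by
      rw [← hz, ← hEq]; exact Finset.sdiff_subset
    have hcard : (P (V ∪ F)).card ≤ 4 * m := by rw [← hz]; omega
    simp only [Finset.mem_biUnion, Finset.mem_image, Finset.mem_filter, Finset.mem_univ, true_and]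
    refine ⟨V ∪ F, ?_, F, ?_, x, hFx, ?_⟩
    · rw [Finset.mem_powersetCard, Finset.card_union_of_disjoint hd]
      exact ⟨Finset.union_subset hVG (hFx.trans (hG x)), by omega⟩
    · simp only [Q, if_pos hcard, Finset.mem_powersetCard]
      exact ⟨hFP, hm⟩
    · rw [Finset.union_sdiff_cancel_right hd]
  have hF : ∀ U, ∀ F ∈ Q U,
      (((Finset.univ.filter fun x => F ⊆ T x).image fun x => (x, U \ F)).card : ℝ) ≤
        Fintype.card ι / R ^ m := by
    intro U F hFQ
    have hFm : F.card = m := by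
      simp only [Q] at hFQ
      split_ifs at hFQ
      · exact (Finset.mem_powersetCard.1 hFQ).2
      · simp at hFQ
    rw [le_div_iff₀ (by positivity)]
    refine le_trans ?_ (hFm ▸ hT F)
    gcongr
    exact Finset.card_image_le
  have hQ : ∀ U, ((Q U).card : ℝ) ≤ 16 ^ m := by
    intro U
    have : (Q U).card ≤ 16 ^ m := by
      simp only [Q]
      split_ifs with hc
      · calc ((P U).powersetCard m).card = (P U).card.choose m := Finset.card_powersetCard _ _
          _ ≤ 2 ^ (P U).card := Nat.choose_le_two_pow _ _
          _ ≤ 2 ^ (4 * m) := Nat.pow_le_pow_right (by norm_num) hc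
          _ = 16 ^ m := by rw [pow_mul]; norm_num
      · simp
    exact_mod_cast this
  have hBcard : (B.card : ℝ) ≤
      (G.card.choose (v + m) : ℝ) * (16 ^ m * (Fintype.card ι / R ^ m)) := by
    calc (B.card : ℝ) ≤ ∑ U ∈ G.powersetCard (v + m), ∑ F ∈ Q U,
          (((Finset.univ.filter fun x => F ⊆ T x).image fun x => (x, U \ F)).card : ℝ) := by
          have := (Finset.card_le_card hsub).trans (Finset.card_biUnion_le.trans
            (Finset.sum_le_sum fun U _ => Finset.card_biUnion_le))
          exact_mod_cast this
      _ ≤ ∑ U ∈ G.powersetCard (v + m), 16 ^ m * (Fintype.card ι / R ^ m) := by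
          refine Finset.sum_le_sum fun U _ => ?_
          refine (Finset.sum_le_card_nsmul _ _ _ (hF U)).trans ?_
          rw [nsmul_eq_mul]
          gcongr
          exact hQ U
      _ = _ := by rw [Finset.sum_const, Finset.card_powersetCard, nsmul_eq_mul]
  have hch : (G.card.choose (v + m) : ℝ) * (v : ℝ) ^ m ≤ G.card.choose v * (G.card : ℝ) ^ m := by
    exact_mod_cast choose_add_mul_pow_le_s3 G.card v m
  have hg' : (0 : ℝ) < G.card := by exact_mod_cast hg
  have hpow : (256 : ℝ) ^ m * (G.card : ℝ) ^ m ≤ R ^ m * (v : ℝ) ^ m := by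
    rw [← mul_pow, ← mul_pow]; gcongr
  have h256 : (256 : ℝ) ^ m = 16 ^ m * 16 ^ m := by rw [← mul_pow]; norm_num
  have hpos : (0 : ℝ) < 16 ^ m * (G.card : ℝ) ^ m := by positivity
  refine le_of_mul_le_mul_right ?_ hpos
  calc (B.card : ℝ) * 16 ^ m * (16 ^ m * (G.card : ℝ) ^ m)
      = B.card * (256 ^ m * (G.card : ℝ) ^ m) := by rw [h256]; ring
    _ ≤ (G.card.choose (v + m) : ℝ) * (16 ^ m * (Fintype.card ι / R ^ m)) *
          (R ^ m * (v : ℝ) ^ m) := by gcongr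
    _ = (G.card.choose (v + m) : ℝ) * (v : ℝ) ^ m * (16 ^ m * Fintype.card ι) := by
        field_simp
    _ ≤ G.card.choose v * (G.card : ℝ) ^ m * (16 ^ m * Fintype.card ι) := by gcongr
    _ = _ := by ring

lemma sum_inv_eight_pow_succ_le (N : ℕ) :
    ∑ m ∈ Finset.range N, ((1 : ℝ) / 8) ^ (m + 1) ≤ 1 / 4 := by
  have h : ∑ m ∈ Finset.range N, ((1 : ℝ) / 8) ^ (m + 1) = (1 - (1 / 8) ^ N) / 7 := by
    induction N with
    | zero => simp
    | succ N ih => rw [Finset.sum_range_succ, ih]; ring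
  have : (0 : ℝ) ≤ (1 / 8) ^ N := by positivity
  rw [h]; linarith

/-- Exposing a random `v`-subset of the ground set halves the average size of the members of a
spread family. -/
lemma exists_residue_sum_le_half {α ι : Type*} [DecidableEq α] [Fintype ι] {R : ℝ} (hR : 0 < R)
    {T : ι → Finset α} (hT : IsSpread R T) {G : Finset α} (hG : ∀ x, T x ⊆ G)
    {v : ℕ} (hv : 256 * (G.card : ℝ) ≤ R * v) :
    ∃ Y : ι → Finset α → ι, (∀ x V, T (Y x V) ⊆ T x ∪ V) ∧
      ∑ V ∈ G.powersetCard v, ∑ x, ((T (Y x V) \ V).card : ℝ) ≤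
        1 / 2 * (G.card.choose v * ∑ x, ((T x).card : ℝ)) := by
  classical
  by_cases hE : ∃ y, T y = ∅
  · obtain ⟨y, hy⟩ := hE
    refine ⟨fun _ _ => y, by simp [hy], ?_⟩
    simp only [hy, Finset.empty_sdiff, Finset.card_empty, Nat.cast_zero, Finset.sum_const_zero]
    positivity
  push Not at hE
  have hex : ∀ x V, ∃ y, T y ⊆ T x ∪ V ∧ (T y).card ≤ (T x).card ∧
      ∀ z, T z ⊆ T x ∪ V → (T z).card ≤ (T x).card → (T y \ V).card ≤ (T z \ V).card := by
    intro x V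
    obtain ⟨y, hy, hm⟩ := Finset.exists_min_image
      (Finset.univ.filter fun y => T y ⊆ T x ∪ V ∧ (T y).card ≤ (T x).card)
      (fun y => (T y \ V).card) ⟨x, by simp [Finset.subset_union_left]⟩
    simp only [Finset.mem_filter, Finset.mem_univ, true_and] at hy hm
    exact ⟨y, hy.1, hy.2, fun z h1 h2 => hm z ⟨h1, h2⟩⟩
  choose Y hY hYc hmin using hex
  refine ⟨Y, hY, ?_⟩
  have hcount : ∀ m, _ := fun m => card_large_residue_mul_le hR hT hG (m := m) (v := v)
    (hv := hv) (Y := Y) (hY := hY) (hYc := hYc) (hmin := hmin)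
  rcases isEmpty_or_nonempty ι with hι | ⟨⟨x₀⟩⟩
  · simp
  have hg : 0 < G.card := Finset.card_pos.2 ((hE x₀).mono (hG x₀))
  let p : Finset (ι × Finset α) := Finset.univ ×ˢ G.powersetCard v
  let f : ι × Finset α → ℕ := fun q => (T (Y q.1 q.2) \ q.2).card
  have hpoint : ∀ q ∈ p, (f q : ℝ) ≤ 1 / 4 * ((T q.1).card : ℝ) +
      ∑ m ∈ Finset.range G.card,
        if f q = m + 1 ∧ (T q.1).card < 4 * (m + 1) then ((m + 1 : ℕ) : ℝ) else 0 := by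
    intro q _
    by_cases hs : (T q.1).card < 4 * f q
    · have hfG : f q ≤ G.card := Finset.card_le_card (Finset.sdiff_subset.trans (hG _))
      have hmem : f q - 1 ∈ Finset.range G.card := by rw [Finset.mem_range]; omega
      have hle := Finset.single_le_sum (f := fun m =>
        if f q = m + 1 ∧ (T q.1).card < 4 * (m + 1) then ((m + 1 : ℕ) : ℝ) else 0)
        (fun m _ => by positivity) hmem
      have h1 : f q - 1 + 1 = f q := by omega
      simp only [h1, hs, and_self, if_true] at hle
      have : (0 : ℝ) ≤ (T q.1).card := by positivity
      linarith
    · have h4 : 4 * (f q : ℝ) ≤ (T q.1).card := by exact_mod_cast not_lt.1 hs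
      have : 0 ≤ ∑ m ∈ Finset.range G.card,
        if f q = m + 1 ∧ (T q.1).card < 4 * (m + 1) then ((m + 1 : ℕ) : ℝ) else 0 :=
        Finset.sum_nonneg fun m _ => by positivity
      linarith
  have hlarge : ∀ m, ∑ q ∈ p,
      (if f q = m + 1 ∧ (T q.1).card < 4 * (m + 1) then ((m + 1 : ℕ) : ℝ) else 0) ≤
        (1 / 8) ^ (m + 1) * ((G.card.choose v : ℝ) * Fintype.card ι) := by
    intro m
    rw [← Finset.sum_filter, Finset.sum_const, nsmul_eq_mul]
    have h1 := hcount (m + 1) hg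
    have h2 : ((m + 1 : ℕ) : ℝ) ≤ 2 ^ (m + 1) := by exact_mod_cast Nat.lt_two_pow_self.le
    have h3 : (2 : ℝ) ^ (m + 1) = (1 / 8) ^ (m + 1) * 16 ^ (m + 1) := by
      rw [← mul_pow]; norm_num
    calc _ ≤ (_ : ℝ) * 2 ^ (m + 1) := by gcongr
      _ = (1 / 8) ^ (m + 1) * (_ * 16 ^ (m + 1)) := by rw [h3]; ring
      _ ≤ _ := by gcongr
  have hcardι : (Fintype.card ι : ℝ) ≤ ∑ x, ((T x).card : ℝ) := by
    have : ∑ _x : ι, (1 : ℝ) ≤ ∑ x, ((T x).card : ℝ) :=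
      Finset.sum_le_sum fun x _ => by exact_mod_cast Finset.card_pos.2 (hE x)
    simpa using this
  have hsumT : ∑ q ∈ p, ((T q.1).card : ℝ) = G.card.choose v * ∑ x, ((T x).card : ℝ) := by
    simp only [p]
    rw [Finset.sum_product_right]
    simp
  calc ∑ V ∈ G.powersetCard v, ∑ x, ((T (Y x V) \ V).card : ℝ) = ∑ q ∈ p, (f q : ℝ) := by
        simp only [p, f]
        rw [Finset.sum_product_right]
    _ ≤ _ := Finset.sum_le_sum hpoint
    _ = 1 / 4 * (G.card.choose v * ∑ x, ((T x).card : ℝ)) + ∑ m ∈ Finset.range G.card, ∑ q ∈ p,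
          (if f q = m + 1 ∧ (T q.1).card < 4 * (m + 1) then ((m + 1 : ℕ) : ℝ) else 0) := by
        rw [Finset.sum_add_distrib, ← Finset.mul_sum, hsumT, Finset.sum_comm]
    _ ≤ 1 / 4 * (G.card.choose v * ∑ x, ((T x).card : ℝ)) +
          1 / 4 * ((G.card.choose v : ℝ) * Fintype.card ι) := by
        gcongr
        refine (Finset.sum_le_sum fun m _ => hlarge m).trans ?_
        rw [← Finset.sum_mul]
        gcongr
        exact sum_inv_eight_pow_succ_le _
    _ ≤ 1 / 4 * (G.card.choose v * ∑ x, ((T x).card : ℝ)) +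
          1 / 4 * ((G.card.choose v : ℝ) * ∑ x, ((T x).card : ℝ)) := by gcongr
    _ = _ := by ring

/-- A random set large enough to contain `m` blocks of size `v` reduces the average residue by a
factor `2 ^ m`. -/
lemma sum_minResidue_le {α ι : Type*} [DecidableEq α] [Fintype ι] {R : ℝ} (hR : 0 < R) {v : ℕ}
    (m : ℕ) : ∀ (T : ι → Finset α) (G : Finset α) (w : ℕ), IsSpread R T → (∀ x, T x ⊆ G) →
      256 * (G.card : ℝ) ≤ R * v → m * v ≤ w → w ≤ G.card →
      ∑ W ∈ G.powersetCard w, ∑ x, (minResidue T x W : ℝ) ≤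
        (1 / 2) ^ m * (G.card.choose w * ∑ x, ((T x).card : ℝ)) := by
  induction m with
  | zero =>
    intro T G w _ _ _ _ _
    rw [pow_zero, one_mul, ← Finset.card_powersetCard, ← nsmul_eq_mul]
    refine Finset.sum_le_card_nsmul _ _ _ fun W _ => Finset.sum_le_sum fun x _ => ?_
    exact_mod_cast (minResidue_le T x x W Finset.subset_union_left).trans
      (Finset.card_le_card Finset.sdiff_subset)
  | succ m ih =>
    intro T G w hT hG hv hmw hwG
    have hvw : v ≤ w := by nlinarith
    obtain ⟨Y, hY, hsum⟩ := exists_residue_sum_le_half hR hT hG hv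
    have hYx : ∀ V x, T (Y x V) \ V ⊆ T x := fun V x => by
      rw [sdiff_le_iff, Finset.sup_eq_union, Finset.union_comm]
      exact hY x V
    have hstep : ∀ V ∈ G.powersetCard v,
        ∑ W ∈ (G \ V).powersetCard (w - v), ∑ x, (minResidue T x (V ∪ W) : ℝ) ≤
          (1 / 2) ^ m * ((G.card - v).choose (w - v) * ∑ x, ((T (Y x V) \ V).card : ℝ)) := by
      intro V hV
      obtain ⟨hVG, hVc⟩ := Finset.mem_powersetCard.1 hV
      have hc : (G \ V).card = G.card - v := by rw [Finset.card_sdiff_of_subset hVG, hVc]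
      have h := ih (fun x => T (Y x V) \ V) (G \ V) (w - v) (hT.mono hR.le (hYx V))
        (fun x => Finset.sdiff_subset_sdiff (hG _) subset_rfl)
        (le_trans (by gcongr; exact Finset.sdiff_subset) hv)
        (by rw [Nat.le_sub_iff_add_le hvw]; linarith) (by rw [hc]; omega)
      rw [hc] at h
      refine le_trans ?_ h
      refine Finset.sum_le_sum fun W _ => Finset.sum_le_sum fun x _ => ?_
      obtain ⟨z, hz, hzc⟩ := exists_minResidue (fun x => T (Y x V) \ V) x W
      rw [← hzc]
      have h1 : T (Y z V) ⊆ T x ∪ (V ∪ W) := by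
        intro a ha
        by_cases haV : a ∈ V
        · simp [haV]
        · have := hz (Finset.mem_sdiff.2 ⟨ha, haV⟩)
          rcases Finset.mem_union.1 this with h2 | h2
          · exact Finset.mem_union_left _ (hYx V x h2)
          · simp [h2]
      have h2 := minResidue_le T x (Y z V) (V ∪ W) h1
      rw [← Finset.sup_eq_union, ← sdiff_sdiff_left] at h2
      exact_mod_cast h2
    have hchoose : (G.card.choose v : ℝ) * (G.card - v).choose (w - v) =
        w.choose v * G.card.choose w := by
      have := Nat.choose_mul (n := G.card) (k := w) (s := v) hvw
      rw [mul_comm (w.choose v : ℝ)]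
      exact_mod_cast this.symm
    have hpos : (0 : ℝ) < w.choose v := by exact_mod_cast Nat.choose_pos hvw
    refine le_of_mul_le_mul_left ?_ hpos
    rw [← sum_powersetCard_union G hvw (fun W => ∑ x, (minResidue T x W : ℝ))]
    calc _ ≤ ∑ V ∈ G.powersetCard v,
          (1 / 2 : ℝ) ^ m * ((G.card - v).choose (w - v) * ∑ x, ((T (Y x V) \ V).card : ℝ)) :=
          Finset.sum_le_sum hstep
      _ = (1 / 2) ^ m * ((G.card - v).choose (w - v) *
            ∑ V ∈ G.powersetCard v, ∑ x, ((T (Y x V) \ V).card : ℝ)) := by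
          rw [Finset.mul_sum, Finset.mul_sum]
      _ ≤ (1 / 2) ^ m * ((G.card - v).choose (w - v) *
            (1 / 2 * (G.card.choose v * ∑ x, ((T x).card : ℝ)))) := by gcongr
      _ = (1 / 2) ^ (m + 1) * ((G.card.choose v * (G.card - v).choose (w - v)) *
            ∑ x, ((T x).card : ℝ)) := by ring
      _ = _ := by rw [hchoose]; ring

lemma isSpread_of_card_le {α : Type*} [DecidableEq α] {ℓ k : ℕ} {r : ℝ} (S : Fin ℓ → Finset α)
    (hr : 0 < r) (hS : ∀ i, (S i).card = k)
    (hspread : ∀ Z : Finset α, Z.Nonempty →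
      ((Finset.univ.filter (fun i : Fin ℓ => Z ⊆ S i)).card : ℝ) ≤ r ^ (k - Z.card))
    (hℓ : r ^ k ≤ (ℓ : ℝ)) : IsSpread r S := by
  intro Z
  rcases Z.eq_empty_or_nonempty with rfl | hZ
  · simp
  by_cases hk : Z.card ≤ k
  · calc _ ≤ r ^ (k - Z.card) * r ^ Z.card := by gcongr; exact hspread Z hZ
      _ = r ^ k := by rw [← pow_add, Nat.sub_add_cancel hk]
      _ ≤ _ := by simpa using hℓ
  · have : (Finset.univ.filter fun i => Z ⊆ S i) = ∅ := by
      refine Finset.filter_eq_empty_iff.2 fun i _ h => hk ?_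
      exact (Finset.card_le_card h).trans (hS i).le
    rw [this]
    simp

/-- A spread family of nonempty sets needs a ground set of at least `R` points. -/
lemma IsSpread.le_card {α ι : Type*} [DecidableEq α] [Fintype α] [Fintype ι] [Nonempty ι] {R : ℝ}
    {T : ι → Finset α} (hR : 0 ≤ R) (hT : IsSpread R T) (hne : ∀ x, (T x).Nonempty) :
    R ≤ Fintype.card α := by
  classical
  have hpos : (0 : ℝ) < Fintype.card ι := by exact_mod_cast Fintype.card_pos
  have hcov : (Fintype.card ι : ℝ) ≤
      ∑ a : α, ((Finset.univ.filter fun i => {a} ⊆ T i).card : ℝ) := by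
    have h : (Finset.univ : Finset ι) ⊆
        Finset.univ.biUnion fun a : α => Finset.univ.filter fun i => {a} ⊆ T i := by
      intro i _
      obtain ⟨a, ha⟩ := hne i
      simpa using ⟨a, ha⟩
    have := (Finset.card_le_card h).trans Finset.card_biUnion_le
    exact_mod_cast this
  refine le_of_mul_le_mul_left ?_ hpos
  calc (Fintype.card ι : ℝ) * R
      ≤ (∑ a : α, ((Finset.univ.filter fun i => {a} ⊆ T i).card : ℝ)) * R := by gcongr
    _ = ∑ a : α, ((Finset.univ.filter fun i => {a} ⊆ T i).card : ℝ) * R := Finset.sum_mul ..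
    _ ≤ ∑ _a : α, (Fintype.card ι : ℝ) :=
        Finset.sum_le_sum fun a _ => by simpa using hT {a}
    _ = _ := by simp [mul_comm]

/-- **Main technical lemma** (Lemma 3 of the paper, expectation form).
There is a universal constant `β > 1` such that: for `0 < γ < 1/2`, `0 < ε < 1/2`,
positive integers `k, n`, and `r = β * (1/γ) * log₂ (k/ε)`, if `S : Fin ℓ → Finset (Fin n)`
is an `r`-spread sequence of at least `r ^ k` sets of size exactly `k`, `X` is uniform on
`[ℓ]` and `W ⊆ [n]` is an independent uniformly random set of a fixed size `w ≥ γ * n`, then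
`E[f(X, W)] < ε`.  The expectation is written as an average over all pairs `(x, W)`. -/
theorem expected_chi_lt_eps :
    ∃ β : ℝ, 1 < β ∧
      ∀ (γ ε r : ℝ) (k n ℓ : ℕ) (S : Fin ℓ → Finset (Fin n)),
        0 < γ → γ < 1/2 → 0 < ε → ε < 1/2 → 0 < k → 0 < n →
        r = β * (1/γ) * Real.logb 2 (k / ε) →
        (∀ i, (S i).card = k) →
        -- the sequence is r-spread
        (∀ Z : Finset (Fin n), Z.Nonempty →
          (((Finset.univ.filter (fun i : Fin ℓ => Z ⊆ S i)).card : ℝ) ≤ r ^ (k - Z.card))) →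
        -- at least r ^ k sets
        r ^ k ≤ (ℓ : ℝ) →
        ∀ w : ℕ, γ * n ≤ (w : ℝ) → w ≤ n →
          (∑ x : Fin ℓ, ∑ W ∈ Finset.powersetCard w (Finset.univ : Finset (Fin n)),
              (chiCard S x W : ℝ)) /
            ((ℓ : ℝ) * ((Finset.powersetCard w (Finset.univ : Finset (Fin n))).card : ℝ))
            < ε := by
  refine ⟨1024, by norm_num, ?_⟩
  intro γ ε r k n ℓ S hγ _ hε hε2 hk hn hr hS hspread hℓ w hw hwn
  set L := Real.logb 2 (k / ε) with hL
  have hk1 : (1 : ℝ) ≤ k := by exact_mod_cast hk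
  have hn0 : (0 : ℝ) < n := by exact_mod_cast hn
  have hkε : 2 < (k : ℝ) / ε := by rw [lt_div_iff₀ hε]; linarith
  have hL1 : 1 < L := by
    rw [hL, Real.lt_logb_iff_rpow_lt (by norm_num) (by linarith)]
    simpa using hkε
  have hγr : γ * r = 1024 * L := by rw [hr]; field_simp
  have hr0 : 0 < r := by rw [hr]; positivity
  have hT : IsSpread r S := isSpread_of_card_le S hr0 hS hspread hℓ
  have hℓ0 : (0 : ℝ) < ℓ := (pow_pos hr0 k).trans_le hℓ
  have : Nonempty (Fin ℓ) := ⟨⟨0, by exact_mod_cast hℓ0⟩⟩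
  have hrn : r ≤ n := by
    simpa using hT.le_card hr0.le fun x => Finset.card_pos.1 (by rw [hS]; exact hk)
  set m := ⌊L⌋₊ + 1 with hm
  have hm0 : 0 < m := by omega
  have hmL : (m : ℝ) ≤ 2 * L := by
    have := Nat.floor_le (a := L) (by linarith)
    rw [hm]; push_cast; linarith
  have hLm : L < m := by rw [hm]; push_cast; exact Nat.lt_floor_add_one L
  have hγn : 1024 * L ≤ γ * n := hγr ▸ by gcongr
  have hmw : m ≤ w := by
    have : (m : ℝ) ≤ w := by linarith
    exact_mod_cast this
  have hv1 : 1 ≤ w / m := (Nat.one_le_div_iff hm0).2 hmw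
  have hwv : (w : ℝ) ≤ 4 * L * (w / m : ℕ) := by
    have h1 : w ≤ 2 * m * (w / m) := by
      have := Nat.div_add_mod w m
      have := Nat.mod_lt w hm0
      nlinarith
    calc (w : ℝ) ≤ 2 * m * (w / m : ℕ) := by exact_mod_cast h1
      _ ≤ 2 * (2 * L) * (w / m : ℕ) := by gcongr
      _ = _ := by ring
  have hv : 256 * ((Finset.univ : Finset (Fin n)).card : ℝ) ≤ r * (w / m : ℕ) := by
    rw [Finset.card_univ, Fintype.card_fin]
    refine le_of_mul_le_mul_left ?_ hγ
    calc γ * (256 * n) = 256 * (γ * n) := by ring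
      _ ≤ 256 * (4 * L * (w / m : ℕ)) := mul_le_mul_of_nonneg_left (hw.trans hwv) (by norm_num)
      _ = γ * r * (w / m : ℕ) := by rw [hγr]; ring
      _ = _ := by ring
  have hmain := sum_minResidue_le hr0 m S Finset.univ w hT (fun x => Finset.subset_univ _) hv
    (Nat.mul_div_le w m) (by simpa using hwn)
  have hC : (0 : ℝ) < n.choose w := by exact_mod_cast Nat.choose_pos hwn
  simp only [hS, Finset.sum_const, Finset.card_univ, Fintype.card_fin, nsmul_eq_mul] at hmain
  rw [Finset.sum_comm, Finset.card_powersetCard, Finset.card_univ, Fintype.card_fin,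
    div_lt_iff₀ (by positivity)]
  have hkm : (k : ℝ) * (1 / 2) ^ m < ε := by
    have h2 : (k : ℝ) / ε < 2 ^ m := by
      rw [← Real.rpow_natCast]
      exact (Real.logb_lt_iff_lt_rpow (by norm_num) (by linarith)).1 hLm
    rw [div_lt_iff₀ hε] at h2
    rw [one_div, inv_pow, ← div_eq_mul_inv, div_lt_iff₀ (by positivity)]
    linarith
  calc _ ≤ (1 / 2 : ℝ) ^ m * (n.choose w * (ℓ * k)) := hmain
    _ = k * (1 / 2) ^ m * (ℓ * n.choose w) := by ring
    _ < ε * (ℓ * n.choose w) := by gcongr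
end
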